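/- arXiv:2108.12896 — 3 statements merged into one kernel-verified Lean document; each statement's English description precedes it below -/
import Mathlib

section
/- Dévissage for local cohomological dimension: let A be a commutative Noetherian ring and I an ideal such that H^j_I(A) = 0 for all j > n. Then H^j_I(M) = 0 for all j > n for every A-module M. -/
/-!
STATEMENT 5: Dévissage for local cohomological dimension: if `A` is commutative Noetherian and
`H^j_I(A) = 0` for all `j > n`, then `H^j_I(M) = 0` for all `j > n` and every `A`-module `M`.
-/

open CategoryTheory

namespace LocalCohomologyDevissage

open Abelian Opposite

universe u

variable {A : Type u} [CommRing A]

/-- Multiplication by `y` as a map `A ⧸ 𝔞 ⟶ A ⧸ 𝔟`, where `y 𝔞 ⊆ 𝔟`. -/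
noncomputable def quotientMul (y : A) (𝔞 𝔟 : Ideal A) (h : ∀ a ∈ 𝔞, y * a ∈ 𝔟) :
    ModuleCat.of A (A ⧸ 𝔞) ⟶ ModuleCat.of A (A ⧸ 𝔟) :=
  ModuleCat.ofHom (Submodule.mapQ 𝔞 𝔟 (LinearMap.mulLeft A y) h)

/-- The projection `A ⧸ 𝔞 ⟶ A ⧸ 𝔟` for `𝔞 ≤ 𝔟`. -/
noncomputable def quotientProj {𝔞 𝔟 : Ideal A} (h : 𝔞 ≤ 𝔟) :
    ModuleCat.of A (A ⧸ 𝔞) ⟶ ModuleCat.of A (A ⧸ 𝔟) :=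
  quotientMul 1 𝔞 𝔟 fun a ha => by simpa using h ha

lemma quotientMul_mk (y : A) (𝔞 𝔟 : Ideal A) (h : ∀ a ∈ 𝔞, y * a ∈ 𝔟) (a : A) :
    (quotientMul y 𝔞 𝔟 h).hom (Ideal.Quotient.mk 𝔞 a) = Ideal.Quotient.mk 𝔟 (y * a) :=
  rfl

lemma quotientProj_mk {𝔞 𝔟 : Ideal A} (h : 𝔞 ≤ 𝔟) (a : A) :
    (quotientProj h).hom (Ideal.Quotient.mk 𝔞 a) = Ideal.Quotient.mk 𝔟 a :=
  (quotientMul_mk 1 𝔞 𝔟 _ a).trans (by rw [one_mul])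

lemma quotient_hom_ext {𝔞 : Ideal A} {M : ModuleCat.{u} A}
    {f g : ModuleCat.of A (A ⧸ 𝔞) ⟶ M}
    (h : ∀ a : A, f.hom (Ideal.Quotient.mk 𝔞 a) = g.hom (Ideal.Quotient.mk 𝔞 a)) : f = g := by
  refine ModuleCat.hom_ext (LinearMap.ext fun x => ?_)
  obtain ⟨a, rfl⟩ := Ideal.Quotient.mk_surjective x
  exact h a

@[simp]
lemma quotientProj_comp {𝔞 𝔟 𝔠 : Ideal A} (h : 𝔞 ≤ 𝔟) (h' : 𝔟 ≤ 𝔠) :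
    quotientProj h ≫ quotientProj h' = quotientProj (h.trans h') :=
  quotient_hom_ext fun a => by
    change Ideal.Quotient.mk 𝔠 (1 * (1 * a)) = Ideal.Quotient.mk 𝔠 (1 * a)
    rw [one_mul]

/-- The direct system `t ↦ Ext^j(A ⧸ J t, M)` has zero colimit. -/
def ExtColimitVanishes (J : ℕ → Ideal A) (hJ : Antitone J) (j : ℕ) (M : ModuleCat.{u} A) : Prop :=
  ∀ (t : ℕ) (ξ : Ext (ModuleCat.of A (A ⧸ J t)) M j), ∃ (s : ℕ) (h : t ≤ s),
    (Ext.mk₀ (quotientProj (hJ h))).comp ξ (zero_add j) = 0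

lemma quotientProj_comp_eq_zero {𝔞 𝔟 𝔠 : Ideal A} (h : 𝔞 ≤ 𝔟) (h' : 𝔟 ≤ 𝔠) {j : ℕ}
    {M : ModuleCat.{u} A} (ξ : Ext (ModuleCat.of A (A ⧸ 𝔠)) M j)
    (hξ : (Ext.mk₀ (quotientProj h')).comp ξ (zero_add j) = 0) :
    (Ext.mk₀ (quotientProj (h.trans h'))).comp ξ (zero_add j) = 0 := by
  rw [← quotientProj_comp h h', ← Ext.mk₀_comp_mk₀_assoc, hξ, Ext.comp_zero]

lemma ExtColimitVanishes.of_cofinal {J J' : ℕ → Ideal A} {hJ : Antitone J} (hJ' : Antitone J')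
    {j : ℕ} {M : ModuleCat.{u} A} (hv : ExtColimitVanishes J hJ j M)
    (h₁ : ∀ t, ∃ s, J s ≤ J' t) (h₂ : ∀ t, ∃ s, J' s ≤ J t) : ExtColimitVanishes J' hJ' j M := by
  intro t ξ
  obtain ⟨a, ha⟩ := h₁ t
  obtain ⟨b, hb, hξ⟩ := hv a ((Ext.mk₀ (quotientProj ha)).comp ξ (zero_add j))
  obtain ⟨c, hc⟩ := h₂ b
  refine ⟨max t c, le_max_left _ _, ?_⟩
  rw [Ext.mk₀_comp_mk₀_assoc, quotientProj_comp] at hξ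
  exact quotientProj_comp_eq_zero ((hJ' (le_max_right t c)).trans hc) _ ξ hξ

lemma ExtColimitVanishes.of_shortExact₂ {J : ℕ → Ideal A} {hJ : Antitone J} {j : ℕ}
    {S : ShortComplex (ModuleCat.{u} A)} (hS : S.ShortExact)
    (h₁ : ExtColimitVanishes J hJ j S.X₁) (h₃ : ExtColimitVanishes J hJ j S.X₃) :
    ExtColimitVanishes J hJ j S.X₂ := by
  intro t ξ
  obtain ⟨s, hs, hξ⟩ := h₃ t (ξ.comp (Ext.mk₀ S.g) (add_zero j))
  rw [← Ext.comp_assoc_of_third_deg_zero] at hξ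
  obtain ⟨η, hη⟩ := Ext.covariant_sequence_exact₂ _ hS _ hξ
  obtain ⟨u, hu, h⟩ := h₁ s η
  refine ⟨u, hs.trans hu, ?_⟩
  rw [← quotientProj_comp (hJ hu) (hJ hs), ← Ext.mk₀_comp_mk₀_assoc, ← hη,
    ← Ext.comp_assoc_of_third_deg_zero, h, Ext.zero_comp]

lemma ExtColimitVanishes.of_shortExact₃ {J : ℕ → Ideal A} {hJ : Antitone J} {j : ℕ}
    {S : ShortComplex (ModuleCat.{u} A)} (hS : S.ShortExact)
    (h₂ : ExtColimitVanishes J hJ j S.X₂) (h₁ : ExtColimitVanishes J hJ (j + 1) S.X₁) :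
    ExtColimitVanishes J hJ j S.X₃ := by
  intro t ξ
  obtain ⟨s, hs, hξ⟩ := h₁ t (ξ.comp hS.extClass rfl)
  rw [← Ext.comp_assoc _ _ _ (zero_add j) rfl (by lia)] at hξ
  obtain ⟨η, hη⟩ := Ext.covariant_sequence_exact₃ _ hS _ rfl hξ
  obtain ⟨u, hu, h⟩ := h₂ s η
  refine ⟨u, hs.trans hu, ?_⟩
  rw [← quotientProj_comp (hJ hu) (hJ hs), ← Ext.mk₀_comp_mk₀_assoc, ← hη,
    ← Ext.comp_assoc_of_third_deg_zero, h, Ext.zero_comp]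

lemma ExtColimitVanishes.of_subsingleton {J : ℕ → Ideal A} (hJ : Antitone J) (j : ℕ)
    (M : ModuleCat.{u} A) [Subsingleton M] : ExtColimitVanishes J hJ j M := fun t ξ =>
  ⟨t, le_rfl, by
    rw [← Ext.comp_mk₀_id ξ, (ModuleCat.isZero_of_subsingleton M).eq_of_src (𝟙 M) 0]
    simp⟩

/-- An extension class of a finitely generated module over a Noetherian ring by `M`
comes from a finitely generated submodule of `M`. -/
lemma exists_fg_ext [IsNoetherianRing A] (M : ModuleCat.{u} A) (j : ℕ) :
    ∀ (N : ModuleCat.{u} A) [Module.Finite A N] (ξ : Ext N M j), ∃ (M' : Submodule A M)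
      (_ : M'.FG) (ξ' : Ext N (ModuleCat.of A M') j),
      ξ = ξ'.comp (Ext.mk₀ (ModuleCat.ofHom M'.subtype)) (add_zero j) := by
  induction j with
  | zero =>
    intro N _ ξ
    obtain ⟨f, rfl⟩ := (Ext.mk₀_bijective N M).2 ξ
    refine ⟨LinearMap.range f.hom, ?_, Ext.mk₀ (ModuleCat.ofHom f.hom.rangeRestrict), ?_⟩
    · rw [LinearMap.range_eq_map]
      exact Module.Finite.fg_top.map _
    · rw [Ext.mk₀_comp_mk₀]
      rfl
  | succ j ih =>
    intro N _ ξ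
    obtain ⟨m, f, hf⟩ := Module.Finite.exists_fin' A N
    have hS := LinearMap.shortExact_shortComplexKer hf
    have : Module.Finite A (LinearMap.ker f) := inferInstance
    have : Projective (ModuleCat.of A (Fin m → A)) := inferInstance
    obtain ⟨η, rfl⟩ := Ext.contravariant_sequence_exact₃ hS M ξ
      (Ext.eq_zero_of_projective _) (add_comm 1 j)
    obtain ⟨M', h, η', hη⟩ := ih _ η
    refine ⟨M', h, hS.extClass.comp η' (add_comm 1 j), ?_⟩
    rw [hη, Ext.comp_assoc_of_third_deg_zero]

lemma ExtColimitVanishes.of_finite [IsNoetherianRing A] {J : ℕ → Ideal A} {hJ : Antitone J}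
    {j : ℕ} (h : ∀ M : ModuleCat.{u} A, Module.Finite A M → ExtColimitVanishes J hJ j M)
    (M : ModuleCat.{u} A) : ExtColimitVanishes J hJ j M := by
  intro t ξ
  obtain ⟨M', hM', ξ', rfl⟩ := exists_fg_ext M j _ ξ
  obtain ⟨s, hs, hξ⟩ := h (ModuleCat.of A M') (Module.Finite.iff_fg.2 hM') t ξ'
  exact ⟨s, hs, by rw [← Ext.comp_assoc_of_third_deg_zero, hξ, Ext.zero_comp]⟩

/-- The colon ideal `(𝔞 : y)`. -/
def colonIdeal (𝔞 : Ideal A) (y : A) : Ideal A :=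
  Submodule.comap (LinearMap.mulLeft A y) 𝔞

lemma mem_colonIdeal {𝔞 : Ideal A} {y a : A} : a ∈ colonIdeal 𝔞 y ↔ y * a ∈ 𝔞 := Iff.rfl

/-- The multiplication by `y` sequence `0 → A ⧸ (𝔞 : y) → A ⧸ 𝔞 → A ⧸ (𝔞 + yA) → 0`. -/
noncomputable def colonComplex (𝔞 : Ideal A) (y : A) : ShortComplex (ModuleCat.{u} A) :=
  ShortComplex.mk (quotientMul y (colonIdeal 𝔞 y) 𝔞 fun _ ha => ha)
    (quotientProj (le_sup_left : 𝔞 ≤ 𝔞 ⊔ Ideal.span {y}))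
    (quotient_hom_ext fun a => by
      change Ideal.Quotient.mk (𝔞 ⊔ Ideal.span {y}) (1 * (y * a)) = 0
      rw [Ideal.Quotient.eq_zero_iff_mem, one_mul]
      exact Ideal.mul_mem_right _ _
        ((le_sup_right : Ideal.span {y} ≤ _) (Ideal.mem_span_singleton_self y)))

lemma colonComplex_shortExact (𝔞 : Ideal A) (y : A) : (colonComplex 𝔞 y).ShortExact := by
  apply ModuleCat.shortComplex_shortExact
  · refine fun x => ⟨fun hx => ?_, ?_⟩
    · obtain ⟨a, rfl⟩ := Ideal.Quotient.mk_surjective x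
      have ha : Ideal.Quotient.mk (𝔞 ⊔ Ideal.span {y}) (1 * a) = 0 := hx
      rw [Ideal.Quotient.eq_zero_iff_mem, one_mul] at ha
      obtain ⟨b, hb, c, hc, rfl⟩ := Submodule.mem_sup.1 ha
      obtain ⟨d, rfl⟩ := Ideal.mem_span_singleton'.1 hc
      refine ⟨Ideal.Quotient.mk (colonIdeal 𝔞 y) d, ?_⟩
      change Ideal.Quotient.mk 𝔞 (y * d) = Ideal.Quotient.mk 𝔞 (b + d * y)
      rw [map_add, Ideal.Quotient.eq_zero_iff_mem.2 hb, zero_add, mul_comm]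
    · rintro ⟨z, rfl⟩
      exact ConcreteCategory.congr_hom (colonComplex 𝔞 y).zero z
  · refine (injective_iff_map_eq_zero (colonComplex 𝔞 y).f.hom).2 fun x hx => ?_
    obtain ⟨a, rfl⟩ := Ideal.Quotient.mk_surjective x
    exact Ideal.Quotient.eq_zero_iff_mem.2
      (mem_colonIdeal.2 (Ideal.Quotient.eq_zero_iff_mem.1 hx))
  · intro x
    obtain ⟨a, rfl⟩ := Ideal.Quotient.mk_surjective x
    exact ⟨Ideal.Quotient.mk 𝔞 a, quotientProj_mk le_sup_left a⟩

variable (x : A) {J : ℕ → Ideal A}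

lemma pow_sub_mul_mem_colonIdeal (hJ : Antitone J) {t s : ℕ} (h : t ≤ s) (a : A)
    (ha : a ∈ colonIdeal (J s) (x ^ s)) : x ^ (s - t) * a ∈ colonIdeal (J t) (x ^ t) := by
  rw [mem_colonIdeal, ← mul_assoc, ← pow_add, Nat.add_sub_cancel' h]
  exact hJ h ha

lemma antitone_sup_span_pow (hJ : Antitone J) :
    Antitone fun t => J t ⊔ Ideal.span {x ^ t} := fun _ _ h =>
  sup_le_sup (hJ h) (Ideal.span_singleton_le_span_singleton.2 (pow_dvd_pow x h))

/-- The sequences `colonComplex (J t) (x ^ t)` form an inverse system. -/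
noncomputable def colonComplexMap (hJ : Antitone J) {t s : ℕ} (h : t ≤ s) :
    colonComplex (J s) (x ^ s) ⟶ colonComplex (J t) (x ^ t) where
  τ₁ := quotientMul (x ^ (s - t)) _ _ (pow_sub_mul_mem_colonIdeal x hJ h)
  τ₂ := quotientProj (hJ h)
  τ₃ := quotientProj (antitone_sup_span_pow x hJ h)
  comm₁₂ := quotient_hom_ext fun a => by
    change Ideal.Quotient.mk (J t) (x ^ t * (x ^ (s - t) * a)) =
      Ideal.Quotient.mk (J t) (1 * (x ^ s * a))
    rw [← mul_assoc, ← pow_add, Nat.add_sub_cancel' h, one_mul]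
  comm₂₃ := quotient_hom_ext fun a => rfl

lemma exists_pow_mul_mem [IsNoetherianRing A] (𝔞 : Ideal A) (x : A) :
    ∃ c : ℕ, ∀ (k : ℕ) (a : A), x ^ k * a ∈ 𝔞 → ∀ m, c ≤ m → x ^ m * a ∈ 𝔞 := by
  let f : ℕ →o Ideal A :=
    { toFun := fun k => colonIdeal 𝔞 (x ^ k)
      monotone' := fun k l h a ha => by
        rw [mem_colonIdeal, ← Nat.sub_add_cancel h, pow_add, mul_assoc]
        exact 𝔞.mul_mem_left _ ha }
  obtain ⟨c, hc⟩ := monotone_stabilizes_iff_noetherian.2 ‹IsNoetherianRing A› f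
  refine ⟨c, fun k a ha m hm => ?_⟩
  have h₁ : a ∈ f (max k c) := f.monotone (le_max_left k c) ha
  rw [← hc _ (le_max_right k c)] at h₁
  exact f.monotone hm h₁

/-- If `Ext^j(A ⧸ J t, M)` has zero colimit then so does `Ext^j(A ⧸ (J t : x^t), M)`, the
transition maps of the latter being induced by multiplication by `x`. -/
lemma exists_quotientMul_comp_eq_zero [IsNoetherianRing A] {hJ : Antitone J} {j : ℕ}
    {M : ModuleCat.{u} A} (hv : ExtColimitVanishes J hJ j M) (t : ℕ)
    (ξ : Ext (ModuleCat.of A (A ⧸ colonIdeal (J t) (x ^ t))) M j) :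
    ∃ (s : ℕ) (h : t ≤ s), (Ext.mk₀ (quotientMul (x ^ (s - t)) _ _
      (pow_sub_mul_mem_colonIdeal x hJ h))).comp ξ (zero_add j) = 0 := by
  have hle : J t ≤ colonIdeal (J t) (x ^ t) := fun a ha => (J t).mul_mem_left _ ha
  obtain ⟨s, hs, hξ⟩ := hv t ((Ext.mk₀ (quotientProj hle)).comp ξ (zero_add j))
  rw [Ext.mk₀_comp_mk₀_assoc, quotientProj_comp] at hξ
  obtain ⟨c, hc⟩ := exists_pow_mul_mem (J s) x
  refine ⟨s + c, by lia, ?_⟩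
  have key : quotientMul (x ^ (s + c - t)) (colonIdeal (J (s + c)) (x ^ (s + c))) (J s)
      (fun a ha => hc _ a (hJ (Nat.le_add_right s c) ha) _ (by lia)) ≫
        quotientProj ((hJ hs).trans hle) = quotientMul (x ^ (s + c - t)) _ _
      (pow_sub_mul_mem_colonIdeal x hJ (by lia)) :=
    quotient_hom_ext fun a => by
      change Ideal.Quotient.mk (colonIdeal (J t) (x ^ t)) (1 * (x ^ (s + c - t) * a)) =
        Ideal.Quotient.mk _ (x ^ (s + c - t) * a)
      rw [one_mul]
  rw [← key, ← Ext.mk₀_comp_mk₀_assoc, hξ, Ext.comp_zero]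

section

universe v w

variable {C : Type v} [Category.{w} C] [Abelian C] [HasExt.{u} C] {S S' : ShortComplex C}

lemma exists_extClass_comp_eq (hS' : S'.ShortExact) (φ : S' ⟶ S) {Y : C} {j : ℕ}
    (ξ : Ext S.X₃ Y (j + 1))
    (hξ : (Ext.mk₀ φ.τ₂).comp ((Ext.mk₀ S.g).comp ξ (zero_add _)) (zero_add _) = 0) :
    ∃ η : Ext S'.X₁ Y j, hS'.extClass.comp η (add_comm 1 j) =
      (Ext.mk₀ φ.τ₃).comp ξ (zero_add _) := by
  rw [Ext.mk₀_comp_mk₀_assoc, φ.comm₂₃, ← Ext.mk₀_comp_mk₀_assoc] at hξ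
  exact Ext.contravariant_sequence_exact₃ hS' Y _ hξ (add_comm 1 j)

lemma mk₀_comp_extClass_comp_eq_zero (hS : S.ShortExact) (hS' : S'.ShortExact) (φ : S' ⟶ S)
    {Y : C} {j : ℕ} (η : Ext S.X₁ Y j) (hη : (Ext.mk₀ φ.τ₁).comp η (zero_add _) = 0) :
    (Ext.mk₀ φ.τ₃).comp (hS.extClass.comp η (add_comm 1 j)) (zero_add _) = 0 := by
  rw [← Ext.comp_assoc (a₁₂ := 1) _ _ _ (zero_add 1) (add_comm 1 j) (by lia),
    ← ShortComplex.ShortExact.extClass_naturality hS' hS φ,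
    Ext.comp_assoc (a₂₃ := j) _ _ _ (add_zero 1) (zero_add j) (by lia), hη, Ext.comp_zero]

end

lemma ExtColimitVanishes.sup_span_pow [IsNoetherianRing A] {hJ : Antitone J} {j : ℕ}
    {M : ModuleCat.{u} A} (hv : ExtColimitVanishes J hJ j M)
    (hv' : ExtColimitVanishes J hJ (j + 1) M) :
    ExtColimitVanishes _ (antitone_sup_span_pow x hJ) (j + 1) M := by
  intro t ξ
  obtain ⟨s, hs, hξ⟩ := hv' t ((Ext.mk₀ (colonComplex (J t) (x ^ t)).g).comp ξ (zero_add _))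
  obtain ⟨η, hη⟩ := exists_extClass_comp_eq (colonComplex_shortExact (J s) (x ^ s))
    (colonComplexMap x hJ hs) ξ hξ
  obtain ⟨u, hu, h⟩ := exists_quotientMul_comp_eq_zero x hv s η
  have h₃ := mk₀_comp_extClass_comp_eq_zero (colonComplex_shortExact (J s) (x ^ s))
    (colonComplex_shortExact (J u) (x ^ u)) (colonComplexMap x hJ hu) η h
  refine ⟨u, hs.trans hu, ?_⟩
  rw [← quotientProj_comp (antitone_sup_span_pow x hJ hu) (antitone_sup_span_pow x hJ hs),
    ← Ext.mk₀_comp_mk₀_assoc]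
  rw [hη] at h₃
  exact h₃

lemma antitone_ideal_pow (I : Ideal A) : Antitone fun t : ℕ => I ^ t :=
  fun _ _ => Ideal.pow_le_pow_right

lemma ExtColimitVanishes.pow_sup_span [IsNoetherianRing A] {I : Ideal A} {j : ℕ}
    {M : ModuleCat.{u} A} (hv : ExtColimitVanishes _ (antitone_ideal_pow I) j M)
    (hv' : ExtColimitVanishes _ (antitone_ideal_pow I) (j + 1) M) :
    ExtColimitVanishes _ (antitone_ideal_pow (Ideal.span {x} ⊔ I)) (j + 1) M := by
  refine (hv.sup_span_pow x hv').of_cofinal _ (fun t => ⟨t, ?_⟩) fun t => ⟨t + t, ?_⟩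
  · rw [← Ideal.span_singleton_pow]
    exact sup_le (Ideal.pow_right_mono le_sup_right t) (Ideal.pow_right_mono le_sup_left t)
  · rw [← Ideal.span_singleton_pow, sup_comm (I ^ t)]
    exact Ideal.sup_pow_add_le_pow_sup_pow

/-- The cohomological dimension of a finitely generated ideal is finite. -/
lemma exists_forall_extColimitVanishes [IsNoetherianRing A] (I : Ideal A) :
    ∃ d : ℕ, ∀ j, d < j → ∀ M : ModuleCat.{u} A,
      ExtColimitVanishes _ (antitone_ideal_pow I) j M := by
  classical
  obtain ⟨S, rfl⟩ := (isNoetherian_def.1 ‹IsNoetherianRing A›) I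
  induction S using Finset.induction_on with
  | empty =>
    refine ⟨0, fun j hj M t ξ => ⟨max t 1, le_max_left _ _, ?_⟩⟩
    obtain ⟨j, rfl⟩ := Nat.exists_eq_add_one.2 hj
    have hbot : ∀ {𝔞 : Ideal A}, 𝔞 = ⊥ → ∀ η : Ext (ModuleCat.of A (A ⧸ 𝔞)) M (j + 1), η = 0 := by
      rintro _ rfl η
      have : Module.Projective A (A ⧸ (⊥ : Ideal A)) :=
        Module.Projective.of_equiv (Submodule.quotEquivOfEqBot (⊥ : Ideal A) rfl).symm
      have : Projective (ModuleCat.of A (A ⧸ (⊥ : Ideal A))) := inferInstance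
      exact Ext.eq_zero_of_projective η
    refine hbot ?_ _
    simp
  | insert x S _ ih =>
    obtain ⟨d, hd⟩ := ih
    refine ⟨d + 1, fun j hj M => ?_⟩
    obtain ⟨j, rfl⟩ := Nat.exists_eq_add_one.2 (Nat.zero_lt_of_lt hj)
    have := (hd j (by lia) M).pow_sup_span x (hd (j + 1) (by lia) M)
    rw [Finset.coe_insert, Submodule.span_insert]
    exact this

/-- Dévissage for the vanishing of the colimit of `Ext^j(A ⧸ I^t, M)`. -/
lemma extColimitVanishes_of_self [IsNoetherianRing A] (I : Ideal A) (n : ℕ)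
    (hA : ∀ j, n < j → ExtColimitVanishes _ (antitone_ideal_pow I) j (ModuleCat.of A A)) :
    ∀ j, n < j → ∀ M : ModuleCat.{u} A, ExtColimitVanishes _ (antitone_ideal_pow I) j M := by
  obtain ⟨d, hd⟩ := exists_forall_extColimitVanishes I
  suffices ∀ k j, n < j → d < j + k → ∀ M : ModuleCat.{u} A,
      ExtColimitVanishes _ (antitone_ideal_pow I) j M from
    fun j hj => this (d + 1) j hj (by lia)
  intro k
  induction k with
  | zero => exact fun j _ h => hd j h
  | succ k ih =>
    intro j hj h M
    refine ExtColimitVanishes.of_finite (fun M hM => ?_) M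
    have hj' := ih (j + 1) (by lia) (by lia)
    refine IsNoetherianRing.induction_on_isQuotientEquivQuotientPrime A hM
      (motive := fun N _ _ _ =>
        ExtColimitVanishes _ (antitone_ideal_pow I) j (ModuleCat.of A N)) ?_ ?_ ?_
    · intro N _ _ _ _
      exact .of_subsingleton _ _ _
    · intro N _ _ _ p e
      have hS := LinearMap.shortExact_shortComplexKer
        (f := e.symm.toLinearMap ∘ₗ Submodule.mkQ p.1)
        (e.symm.surjective.comp (Submodule.mkQ_surjective _))
      exact .of_shortExact₃ hS (hA j hj) (hj' _)
    · intro N₁ _ _ _ N₂ _ _ _ N₃ _ _ _ f g hf hg hfg h₁ h₃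
      exact .of_shortExact₂ (ModuleCat.shortComplex_shortExact (ShortComplex.mk
        (ModuleCat.ofHom f) (ModuleCat.ofHom g)
        (ModuleCat.hom_ext hfg.linearMap_comp_eq_zero)) hfg hf hg) h₁ h₃

/-- The complex `Hom(P, Y)`, as a chain complex in the opposite category. -/
noncomputable abbrev homComplex {X : ModuleCat.{u} A} (P : ProjectiveResolution X)
    (Y : ModuleCat.{u} A) : ChainComplex (ModuleCat.{u} A)ᵒᵖ ℕ :=
  ((((linearYoneda A (ModuleCat.{u} A)).obj Y).rightOp).mapHomologicalComplex _).obj P.complex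

/-- The derived functor `Ext`, evaluated at two modules. -/
noncomputable abbrev derivedExt (X Y : ModuleCat.{u} A) (n : ℕ) : ModuleCat.{u} A :=
  ((_root_.Ext A (ModuleCat.{u} A) n).obj (op X)).obj Y

/-- The class in `derivedExt X Y n` of a cocycle of `Hom(P, Y)`. -/
noncomputable def cocycleClass {X : ModuleCat.{u} A} (P : ProjectiveResolution X)
    (Y : ModuleCat.{u} A) (n : ℕ) : ((homComplex P Y).opcycles n).unop ⟶ derivedExt X Y n :=
  ((homComplex P Y).homologyι n).unop ≫
    (P.isoLeftDerivedObj ((linearYoneda A (ModuleCat.{u} A)).obj Y).rightOp n).hom.unop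

/-- The inclusion of cocycles in `Hom(P, Y)`. -/
noncomputable def cocycleIncl {X : ModuleCat.{u} A} (P : ProjectiveResolution X)
    (Y : ModuleCat.{u} A) (n : ℕ) :
    ((homComplex P Y).opcycles n).unop ⟶ ModuleCat.of A (P.complex.X n ⟶ Y) :=
  ((homComplex P Y).pOpcycles n).unop

/-- The cochain `g` is a cocycle representing `x`. -/
def Represents {X : ModuleCat.{u} A} (P : ProjectiveResolution X) {Y : ModuleCat.{u} A} {n : ℕ}
    (x : derivedExt X Y n) (g : P.complex.X n ⟶ Y) : Prop :=
  ∃ z, (cocycleIncl P Y n).hom z = g ∧ (cocycleClass P Y n).hom z = x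

variable {X : ModuleCat.{u} A} (P : ProjectiveResolution X) {Y : ModuleCat.{u} A} {n : ℕ}

lemma exists_represents (x : derivedExt X Y n) : ∃ g, Represents P x g := by
  have : Epi (cocycleClass P Y n) :=
    @epi_comp _ _ _ _ _ _ (unop_epi_of_mono _) _ (unop_epi_of_mono _)
  obtain ⟨z, hz⟩ := (ModuleCat.epi_iff_surjective _).1 this x
  exact ⟨_, z, rfl, hz⟩

lemma cocycleIncl_injective : Function.Injective (cocycleIncl P Y n).hom := by
  have : Mono (cocycleIncl P Y n) := unop_mono_of_epi ((homComplex P Y).pOpcycles n)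
  exact (ModuleCat.mono_iff_injective _).1 this

lemma Represents.d_comp {x : derivedExt X Y n} {g : P.complex.X n ⟶ Y} (h : Represents P x g) :
    P.complex.d (n + 1) n ≫ g = 0 := by
  obtain ⟨z, rfl, -⟩ := h
  have h := congrArg Quiver.Hom.unop ((homComplex P Y).d_pOpcycles (n + 1) n)
  exact congr($(h).hom z)

lemma exists_represented (g : P.complex.X n ⟶ Y) (hg : P.complex.d (n + 1) n ≫ g = 0) :
    ∃ x : derivedExt X Y n, Represents P x g := by
  have h : (ShortComplex.mk _ _ ((homComplex P Y).d_pOpcycles (n + 1) n)).Exact :=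
    ShortComplex.exact_of_g_is_cokernel _
      ((homComplex P Y).opcyclesIsCokernel (n + 1) n (by simp))
  obtain ⟨z, hz⟩ := (ShortComplex.moduleCat_exact_iff _).1 h.unop g hg
  exact ⟨_, z, hz, rfl⟩

lemma Represents.eq_zero_iff {x : derivedExt X Y (n + 1)} {g : P.complex.X (n + 1) ⟶ Y}
    (h : Represents P x g) : x = 0 ↔ ∃ f, P.complex.d (n + 1) n ≫ f = g := by
  obtain ⟨z, rfl, rfl⟩ := h
  have hex : (ShortComplex.mk _ _ ((homComplex P Y).homologyι_comp_fromOpcycles (n + 1) n)).Exact :=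
    ShortComplex.exact_of_f_is_kernel _
      ((homComplex P Y).homologyIsKernel (n + 1) n (by simp))
  have hz : (cocycleClass P Y (n + 1)).hom z = 0 ↔
      (((homComplex P Y).homologyι (n + 1)).unop).hom z = 0 := by
    refine map_eq_zero_iff (ModuleCat.Hom.hom (P.isoLeftDerivedObj
      ((linearYoneda A (ModuleCat.{u} A)).obj Y).rightOp (n + 1)).hom.unop)
      ((ModuleCat.mono_iff_injective _).1 inferInstance)
  have hd (f : P.complex.X n ⟶ Y) : (cocycleIncl P Y (n + 1)).hom
      ((((homComplex P Y).fromOpcycles (n + 1) n).unop).hom f) = P.complex.d (n + 1) n ≫ f := by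
    have h := congrArg Quiver.Hom.unop ((homComplex P Y).p_fromOpcycles (n + 1) n)
    exact congr($(h).hom f)
  rw [hz]
  constructor
  · intro h0
    obtain ⟨f, hf⟩ := (ShortComplex.moduleCat_exact_iff _).1 hex.unop z h0
    exact ⟨f, (hd f).symm.trans (congrArg _ hf)⟩
  · rintro ⟨f, hf⟩
    rw [← hd] at hf
    rw [← cocycleIncl_injective P hf]
    have h := congrArg Quiver.Hom.unop
      ((homComplex P Y).homologyι_comp_fromOpcycles (n + 1) n)
    exact congr($(h).hom f)

/-- The action of a map of modules on `derivedExt`. -/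
noncomputable def derivedExtMap {X' : ModuleCat.{u} A} (f : X' ⟶ X) (Y : ModuleCat.{u} A) (n : ℕ) :
    derivedExt X Y n ⟶ derivedExt X' Y n :=
  ((_root_.Ext A (ModuleCat.{u} A) n).map f.op).app Y

variable {P} in
lemma Represents.map {X' : ModuleCat.{u} A} {f : X' ⟶ X} {P' : ProjectiveResolution X'}
    (φ : P'.Hom P f) {x : derivedExt X Y n} {g : P.complex.X n ⟶ Y} (h : Represents P x g) :
    Represents P' ((derivedExtMap f Y n).hom x) (φ.hom.f n ≫ g) := by
  obtain ⟨z, rfl, rfl⟩ := h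
  let F := ((linearYoneda A (ModuleCat.{u} A)).obj Y).rightOp
  let ψ : homComplex P' Y ⟶ homComplex P Y := (F.mapHomologicalComplex _).map φ.hom
  refine ⟨((HomologicalComplex.opcyclesMap ψ n).unop).hom z, ?_, ?_⟩
  · have h := congrArg Quiver.Hom.unop (HomologicalComplex.p_opcyclesMap ψ n)
    exact congr($(h).hom z)
  · have h₁ := congrArg Quiver.Hom.unop (HomologicalComplex.homologyι_naturality ψ n)
    have h₂ := congrArg Quiver.Hom.unop
      (ProjectiveResolution.isoLeftDerivedObj_hom_naturality f P' P φ.hom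
        (by simpa using φ.hom_f_zero_comp_π_f_zero) F n)
    have e₁ := congr($(h₁).hom z)
    have e₂ := congr($(h₂).hom (((homComplex P Y).homologyι n).unop.hom z))
    refine Eq.trans ?_ e₂.symm
    exact congrArg (ModuleCat.Hom.hom (P'.isoLeftDerivedObj F n).hom.unop) e₁.symm

/-- `x` and `ξ` are the classes of a common cocycle. -/
def Linked (x : derivedExt X Y n) (ξ : Abelian.Ext X Y n) : Prop :=
  ∃ g hg, Represents P x g ∧ P.extMk g (n + 1) rfl hg = ξ

lemma exists_linked_left (ξ : Abelian.Ext X Y n) : ∃ x, Linked P x ξ := by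
  obtain ⟨g, hg, rfl⟩ := P.extMk_surjective ξ (n + 1) rfl
  obtain ⟨x, hx⟩ := exists_represented P g hg
  exact ⟨x, g, hg, hx, rfl⟩

lemma exists_linked_right (x : derivedExt X Y n) : ∃ ξ, Linked P x ξ := by
  obtain ⟨g, hx⟩ := exists_represents P x
  exact ⟨_, g, hx.d_comp, hx, rfl⟩

variable {P}

lemma Linked.eq_zero_iff {x : derivedExt X Y (n + 1)} {ξ : Abelian.Ext X Y (n + 1)}
    (h : Linked P x ξ) : x = 0 ↔ ξ = 0 := by
  obtain ⟨g, hg, hx, rfl⟩ := h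
  rw [hx.eq_zero_iff, P.extMk_eq_zero_iff g _ rfl hg n rfl]

lemma Linked.map {X' : ModuleCat.{u} A} {f : X' ⟶ X} {P' : ProjectiveResolution X'}
    (φ : P'.Hom P f) {x : derivedExt X Y n} {ξ : Abelian.Ext X Y n} (h : Linked P x ξ) :
    Linked P' ((derivedExtMap f Y n).hom x) ((Ext.mk₀ f).comp ξ (zero_add n)) := by
  obtain ⟨g, hg, hx, rfl⟩ := h
  exact ⟨φ.hom.f n ≫ g, _, hx.map φ, (P.mk₀_comp_extMk g _ rfl hg φ).symm⟩

lemma Linked.map_eq_zero_iff {X' : ModuleCat.{u} A} (f : X' ⟶ X)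
    {x : derivedExt X Y (n + 1)} {ξ : Abelian.Ext X Y (n + 1)} (h : Linked P x ξ) :
    (derivedExtMap f Y (n + 1)).hom x = 0 ↔ (Ext.mk₀ f).comp ξ (zero_add (n + 1)) = 0 :=
  (h.map (P' := projectiveResolution X')
    { hom := ProjectiveResolution.lift f _ _
      hom_f_zero_comp_π_f_zero := by
        simpa using ProjectiveResolution.lift_commutes_zero f (projectiveResolution X') P
      }).eq_zero_iff

lemma subsingleton_colimit_iff {B : Type} [CommRing B] {F : ℕᵒᵖᵒᵖ ⥤ ModuleCat.{0} B}
    {c : Limits.Cocone F} (hc : Limits.IsColimit c) :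
    Subsingleton c.pt ↔ ∀ (t : ℕ) (x : F.obj (op (op t))), ∃ (s : ℕ) (h : t ≤ s),
      (F.map (homOfLE h).op.op).hom x = 0 := by
  constructor
  · intro hs t x
    obtain ⟨k, f, hf⟩ := (hc.eq_iff' x 0).1 (@Subsingleton.elim _ hs _ _)
    exact ⟨k.unop.unop, leOfHom f.unop.unop, hf.trans (map_zero _)⟩
  · intro h
    refine subsingleton_of_forall_eq 0 fun y => ?_
    obtain ⟨k, x, rfl⟩ := Limits.Concrete.isColimit_exists_rep F hc y
    obtain ⟨s, hs, hx⟩ := h k.unop.unop x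
    have hw := congr($(c.w (homOfLE hs).op.op).hom x)
    exact hw.symm.trans ((congrArg (c.ι.app (op (op s))).hom hx).trans (map_zero _))

lemma subsingleton_localCohomology_iff {B : Type} [CommRing B] (I : Ideal B) (n : ℕ)
    (M : ModuleCat.{0} B) : Subsingleton ((localCohomology I (n + 1)).obj M) ↔
      ExtColimitVanishes _ (antitone_ideal_pow I) (n + 1) M := by
  let D := localCohomology.diagram (localCohomology.idealPowersDiagram I) (n + 1)
  let ev := (evaluation (ModuleCat.{0} B) (ModuleCat.{0} B)).obj M
  refine (subsingleton_colimit_iff (Limits.isColimitOfPreserves ev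
    (Limits.colimit.isColimit D))).trans ?_
  have hmap {t s : ℕ} (h : t ≤ s) (x : derivedExt (ModuleCat.of B (B ⧸ I ^ t)) M (n + 1)) :
      ((D ⋙ ev).map (homOfLE h).op.op).hom x =
        (derivedExtMap (quotientProj (antitone_ideal_pow I h)) M (n + 1)).hom x := by
    have hq : (localCohomology.ringModIdeals (localCohomology.idealPowersDiagram I)).map
        (homOfLE h).op = quotientProj (antitone_ideal_pow I h) :=
      quotient_hom_ext fun a => (quotientProj_mk (antitone_ideal_pow I h) a).symm
    exact congr((derivedExtMap $hq M (n + 1)).hom x)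
  constructor
  · intro h t ξ
    obtain ⟨x, hx⟩ := exists_linked_left (projectiveResolution _) ξ
    obtain ⟨s, hs, h0⟩ := h t x
    exact ⟨s, hs, (hx.map_eq_zero_iff _).1 ((hmap hs x).symm.trans h0)⟩
  · intro h t x
    obtain ⟨ξ, hx⟩ := exists_linked_right
      (projectiveResolution (ModuleCat.of B (B ⧸ I ^ t))) (Y := M) (n := n + 1) x
    obtain ⟨s, hs, h0⟩ := h t ξ
    exact ⟨s, hs, (hmap hs x).trans ((hx.map_eq_zero_iff _).2 h0)⟩

end LocalCohomologyDevissage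

theorem local_cohomology_devissage
    (A : Type) [CommRing A] [IsNoetherianRing A] (I : Ideal A) (n : ℕ)
    (hA : ∀ j : ℕ, n < j → Subsingleton ((localCohomology I j).obj (ModuleCat.of A A))) :
    ∀ (M : ModuleCat A) (j : ℕ), n < j → Subsingleton ((localCohomology I j).obj M) := by
  have key (M : ModuleCat A) (j : ℕ) (hj : n < j) :
      Subsingleton ((localCohomology I j).obj M) ↔
        LocalCohomologyDevissage.ExtColimitVanishes _
          (LocalCohomologyDevissage.antitone_ideal_pow I) j M := by
    obtain ⟨p, rfl⟩ := Nat.exists_eq_succ_of_ne_zero (Nat.ne_zero_of_lt hj)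
    exact LocalCohomologyDevissage.subsingleton_localCohomology_iff I p M
  intro M j hj
  exact (key M j hj).2 (LocalCohomologyDevissage.extColimitVanishes_of_self I n
    (fun j hj => (key _ j hj).1 (hA j hj)) j hj M)
end

section
/- Grothendieck vanishing bound for local cohomological dimension: if A is a commutative Noetherian ring of Krull dimension d and I ⊆ A is an ideal, then H^j_I(M) = 0 for all j > d and all A-modules M. -/
/-!
STATEMENT 6: Grothendieck vanishing bound: if `A` is commutative Noetherian of Krull dimension
at most `d` and `I ⊆ A` is an ideal, then `H^j_I(M) = 0` for all `j > d` and all `A`-modules `M`.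
-/

open CategoryTheory
universe u

variable {A : Type u} [CommRing A]

/-- The short complex `M ⟶ N ⟶ N ⧸ range f` attached to a linear map `f : M →ₗ[A] N`. -/
noncomputable abbrev LinearMap.cokernelShortComplex {M N : Type u} [AddCommGroup M] [Module A M]
    [AddCommGroup N] [Module A N] (f : M →ₗ[A] N) : ShortComplex (ModuleCat.{u} A) :=
  ShortComplex.mk (ModuleCat.ofHom f) (ModuleCat.ofHom (LinearMap.range f).mkQ)
    (by rw [← ModuleCat.ofHom_comp, LinearMap.range_mkQ_comp]; rfl)

lemma LinearMap.shortExact_cokernelShortComplex {M N : Type u} [AddCommGroup M] [Module A M]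
    [AddCommGroup N] [Module A N] (f : M →ₗ[A] N) (hf : Function.Injective f) :
    f.cokernelShortComplex.ShortExact where
  exact := by
    rw [ShortComplex.moduleCat_exact_iff_range_eq_ker]
    exact (Submodule.ker_mkQ _).symm
  mono_f := (ModuleCat.mono_iff_injective _).2 hf
  epi_g := (ModuleCat.epi_iff_surjective _).2 (Submodule.mkQ_surjective _)

/-- Every element of the derived-functor `Ext` in positive degree is represented by a class in
`Abelian.Ext` whose vanishing after restriction implies that of the original element. -/
lemma CategoryTheory.Abelian.Ext.exists_detects_Ext_map {A : Type u} [CommRing A]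
    {X M : ModuleCat.{u} A} (n : ℕ)
    (e : ((_root_.Ext A (ModuleCat.{u} A) (n + 1)).obj (.op X)).obj M) :
    ∃ ξ : Abelian.Ext X M (n + 1), ∀ (Y : ModuleCat.{u} A) (g : Y ⟶ X),
      (Abelian.Ext.mk₀ g).comp ξ (zero_add _) = 0 →
        ((_root_.Ext A (ModuleCat.{u} A) (n + 1)).map g.op).app M e = 0 := by
  let F := ((linearYoneda A (ModuleCat.{u} A)).obj M).rightOp
  let P := projectiveResolution X
  let KP := (F.mapHomologicalComplex (ComplexShape.down ℕ)).obj P.complex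
  obtain ⟨e', he'⟩ : ∃ e' : (KP.homology (n+1)).unop,
      e = (P.isoLeftDerivedObj F (n + 1)).hom.unop e' := by
    refine ⟨(P.isoLeftDerivedObj F (n + 1)).inv.unop e, ?_⟩
    have := (P.isoLeftDerivedObj F (n + 1)).hom_inv_id
    exact (congr($(congrArg Quiver.Hom.unop this) e)).symm
  have hs : Function.Surjective (KP.homologyι (n+1)).unop := by
    rw [← ModuleCat.epi_iff_surjective]; infer_instance
  obtain ⟨z, rfl⟩ := hs e'
  let f : P.complex.X (n+1) ⟶ M := (KP.pOpcycles (n+1)).unop z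
  have hf : P.complex.d (n+2) (n+1) ≫ f = 0 := by
    have := KP.d_pOpcycles (n+2) (n+1)
    have h2 := congr($(congrArg Quiver.Hom.unop this) z)
    exact h2
  refine ⟨P.extMk f (n+2) rfl hf, fun Y g hg => ?_⟩
  let Q := projectiveResolution Y
  let KQ := (F.mapHomologicalComplex (ComplexShape.down ℕ)).obj Q.complex
  let φ : ProjectiveResolution.Hom Q P g :=
    ⟨ProjectiveResolution.lift g Q P, ProjectiveResolution.lift_commutes_zero g Q P⟩
  rw [ProjectiveResolution.mk₀_comp_extMk (φ := φ),
    ProjectiveResolution.extMk_eq_zero_iff (p := n) (hp := rfl)] at hg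
  obtain ⟨h, hh⟩ := hg
  let ψ : KQ ⟶ KP := (F.mapHomologicalComplex _).map φ.hom
  have hnat : (F.leftDerived (n + 1)).map g ≫ (P.isoLeftDerivedObj F (n + 1)).hom ≫
      KP.homologyι (n + 1) = (Q.isoLeftDerivedObj F (n + 1)).hom ≫ KQ.homologyι (n + 1) ≫
        HomologicalComplex.opcyclesMap ψ (n + 1) := by
    refine (Q.isoLeftDerivedObj_hom_naturality_assoc g P φ.hom
      (ProjectiveResolution.lift_commutes_zero g Q P) F (n + 1) (KP.homologyι (n + 1))).trans ?_
    exact congrArg ((Q.isoLeftDerivedObj F (n + 1)).hom ≫ ·)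
      (HomologicalComplex.homologyι_naturality ψ (n + 1))
  have hz : (HomologicalComplex.opcyclesMap ψ (n + 1)).unop z =
      (KQ.fromOpcycles (n + 1) n).unop h := by
    have hi : Function.Injective (KQ.pOpcycles (n + 1)).unop := by
      rw [← ModuleCat.mono_iff_injective]; infer_instance
    apply hi
    have h1 := HomologicalComplex.p_opcyclesMap ψ (n + 1)
    have h2 := congr($(congrArg Quiver.Hom.unop h1) z)
    have h3 := congr($(congrArg Quiver.Hom.unop (KQ.p_fromOpcycles (n + 1) n)) h)
    exact (h2.trans hh.symm).trans h3.symm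
  rw [he']
  refine (congr($(congrArg Quiver.Hom.unop hnat) z)).trans ?_
  change (Q.isoLeftDerivedObj F (n + 1)).hom.unop ((KQ.homologyι (n + 1)).unop
    ((HomologicalComplex.opcyclesMap ψ (n + 1)).unop z)) = 0
  have h4 := congr($(congrArg Quiver.Hom.unop (KQ.homologyι_comp_fromOpcycles (n + 1) n)) h)
  rw [hz]
  refine (congrArg (Q.isoLeftDerivedObj F (n + 1)).hom.unop h4).trans ?_
  exact map_zero (Q.isoLeftDerivedObj F (n + 1)).hom.unop.hom

namespace localCohomology

open Opposite Abelian

variable (I : Ideal A)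

/-- The quotient `A ⧸ I ^ t` as an object of `ModuleCat A`. -/
noncomputable abbrev powQuot (t : ℕ) : ModuleCat.{u} A :=
  (ringModIdeals (idealPowersDiagram I)).obj (op t)

variable {I}

/-- The projection `A ⧸ I ^ s ⟶ A ⧸ I ^ t` for `t ≤ s`. -/
noncomputable abbrev powQuotMap {t s : ℕ} (h : t ≤ s) : powQuot I s ⟶ powQuot I t :=
  (ringModIdeals (idealPowersDiagram I)).map (homOfLE h).op

lemma powQuotMap_comp {t s r : ℕ} (h : t ≤ s) (h' : s ≤ r) :
    (powQuotMap h' : powQuot I r ⟶ _) ≫ powQuotMap h = powQuotMap (h.trans h') := by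
  rw [← Functor.map_comp]; rfl

/-- Restriction of extension classes along `A ⧸ I ^ s ⟶ A ⧸ I ^ t`. -/
noncomputable abbrev resExt {t s : ℕ} (h : t ≤ s) {M : ModuleCat.{u} A} {j : ℕ}
    (ξ : Ext (powQuot I t) M j) : Ext (powQuot I s) M j :=
  (Ext.mk₀ (powQuotMap h)).comp ξ (zero_add j)

/-- An extension class of `A ⧸ I ^ t` by `M` is eventually zero if its restriction to some
`A ⧸ I ^ s` vanishes, i.e. if it vanishes in local cohomology. -/
def EventuallyZero {t : ℕ} {M : ModuleCat.{u} A} {j : ℕ} (ξ : Ext (powQuot I t) M j) : Prop :=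
  ∃ (s : ℕ) (h : t ≤ s), resExt h ξ = 0

lemma EventuallyZero.of_resExt {t s : ℕ} (h : t ≤ s) {M : ModuleCat.{u} A} {j : ℕ}
    {ξ : Ext (powQuot I t) M j} (hξ : EventuallyZero (resExt h ξ)) : EventuallyZero ξ := by
  obtain ⟨r, hr, e⟩ := hξ
  refine ⟨r, h.trans hr, ?_⟩
  rwa [resExt, resExt, Ext.mk₀_comp_mk₀_assoc, powQuotMap_comp] at e

lemma EventuallyZero.comp {t : ℕ} {M N : ModuleCat.{u} A} {i j k : ℕ}
    {ξ : Ext (powQuot I t) M i} (hξ : EventuallyZero ξ) (α : Ext M N j) (h : i + j = k) :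
    EventuallyZero (ξ.comp α h) := by
  obtain ⟨s, hs, e⟩ := hξ
  refine ⟨s, hs, ?_⟩
  rw [resExt] at e
  rw [resExt, ← Ext.comp_assoc _ _ _ (zero_add _) h (by lia), e,
    Ext.zero_comp]

variable (I) in
/-- Every class in `Ext^j(A ⧸ I ^ t, M)` is eventually zero. -/
def ExtVanishes (j : ℕ) (M : ModuleCat.{u} A) : Prop :=
  ∀ (t : ℕ) (ξ : Ext (powQuot I t) M j), EventuallyZero ξ

lemma ExtVanishes.middle {S : ShortComplex (ModuleCat.{u} A)} (hS : S.ShortExact) {j : ℕ}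
    (h₁ : ExtVanishes I j S.X₁) (h₃ : ExtVanishes I j S.X₃) : ExtVanishes I j S.X₂ := by
  intro t ξ
  obtain ⟨s, hs, e⟩ := h₃ t (ξ.comp (Ext.mk₀ S.g) (add_zero _))
  rw [resExt, ← Ext.comp_assoc _ _ _ (zero_add _) (add_zero _) (by lia)] at e
  obtain ⟨η, hη⟩ := Ext.covariant_sequence_exact₂ _ hS _ e
  refine .of_resExt hs ?_
  rw [resExt, ← hη]
  exact (h₁ s η).comp _ _

lemma smul_resExt {t s : ℕ} (h : t ≤ s) {M : ModuleCat.{u} A} {j : ℕ}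
    (ξ : Ext (powQuot I t) M j) (x : A) : resExt h (x • ξ) = x • resExt h ξ := by
  simp [resExt]

lemma pow_smul_ext_eq_zero {x : A} (hx : x ∈ I) {t : ℕ} {M : ModuleCat.{u} A} {j : ℕ}
    (ξ : Ext (powQuot I t) M j) : x ^ t • ξ = 0 := by
  have : x ^ t • 𝟙 (powQuot I t) = 0 := by
    ext y
    obtain ⟨y, rfl⟩ := Submodule.mkQ_surjective _ y
    change Submodule.Quotient.mk (x ^ t • y) = 0
    rw [Submodule.Quotient.mk_eq_zero]
    exact Ideal.mul_mem_right _ _ (Ideal.pow_mem_pow hx t)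
  rw [← Ext.mk₀_id_comp ξ, ← Ext.smul_comp, ← Ext.mk₀_smul, this]
  simp

lemma ExtVanishes.succ_of_injective_smul {x : A} (hx : x ∈ I) {M : ModuleCat.{u} A} {j : ℕ}
    (hM : Function.Injective (LinearMap.lsmul A M x))
    (h : ExtVanishes I j (ModuleCat.of A (M ⧸ LinearMap.range (LinearMap.lsmul A M x)))) :
    ExtVanishes I (j + 1) M := by
  have hS := LinearMap.shortExact_cokernelShortComplex _ hM
  suffices H : ∀ (n t : ℕ) (ξ : Ext (powQuot I t) M (j + 1)), x ^ n • ξ = 0 → EventuallyZero ξ from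
    fun t ξ => H t t ξ (pow_smul_ext_eq_zero hx ξ)
  intro n
  induction n with
  | zero => exact fun t ξ e => ⟨t, le_rfl, by simp_all⟩
  | succ n ih =>
    intro t ξ e
    obtain ⟨s, hs, e⟩ := ih t (x • ξ) (by rwa [smul_smul, ← pow_succ])
    refine .of_resExt hs ?_
    rw [smul_resExt, Ext.smul_eq_comp_mk₀] at e
    obtain ⟨η, hη⟩ := Ext.covariant_sequence_exact₁ _ hS (resExt hs ξ) e rfl
    rw [← hη]
    exact (h s η).comp _ _

/-- Every element of `M` is annihilated by a power of `I`. -/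
def IsPowTorsion (I : Ideal A) (M : Type*) [AddCommGroup M] [Module A M] : Prop :=
  ∀ m : M, ∃ n : ℕ, I ^ n ≤ Ideal.torsionOf A M m

/-- The submodule of elements annihilated by a power of `I`. -/
def powTorsion (I : Ideal A) (M : Type*) [AddCommGroup M] [Module A M] : Submodule A M where
  carrier := {m | ∃ n : ℕ, I ^ n ≤ Ideal.torsionOf A M m}
  zero_mem' := ⟨0, by simp⟩
  add_mem' := by
    rintro a b ⟨n, hn⟩ ⟨k, hk⟩
    refine ⟨max n k, fun x hx => ?_⟩
    have h1 := hn (Ideal.pow_le_pow_right (le_max_left n k) hx)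
    have h2 := hk (Ideal.pow_le_pow_right (le_max_right n k) hx)
    simp_all [Ideal.mem_torsionOf_iff]
  smul_mem' := by
    rintro c a ⟨n, hn⟩
    refine ⟨n, fun x hx => ?_⟩
    have h1 := hn hx
    rw [Ideal.mem_torsionOf_iff] at h1 ⊢
    rw [smul_comm, h1, smul_zero]

lemma isPowTorsion_powTorsion (M : Type*) [AddCommGroup M] [Module A M] :
    IsPowTorsion I (powTorsion I M) := by
  rintro ⟨m, n, hn⟩
  refine ⟨n, fun x hx => ?_⟩
  have h1 := hn hx
  rw [Ideal.mem_torsionOf_iff] at h1 ⊢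
  exact Subtype.ext h1

lemma IsPowTorsion.of_surjective {M N : Type*} [AddCommGroup M] [Module A M]
    [AddCommGroup N] [Module A N] (h : IsPowTorsion I M) (f : M →ₗ[A] N)
    (hf : Function.Surjective f) : IsPowTorsion I N := by
  intro m
  obtain ⟨m, rfl⟩ := hf m
  obtain ⟨n, hn⟩ := h m
  refine ⟨n, fun x hx => ?_⟩
  have h1 := hn hx
  rw [Ideal.mem_torsionOf_iff] at h1 ⊢
  rw [← map_smul, h1, map_zero]

lemma IsPowTorsion.exists_pow_smul_eq_zero {N M : Type*} [AddCommGroup N] [Module A N]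
    [IsNoetherian A N] [AddCommGroup M] [Module A M] (h : IsPowTorsion I M) (g : N →ₗ[A] M) :
    ∃ c : ℕ, ∀ x ∈ I ^ c, ∀ a : N, x • g a = 0 := by
  let P : ℕ →o Submodule A N :=
    ⟨fun c => (Submodule.torsionBySet A M ((I ^ c : Ideal A) : Set A)).comap g, fun i j hij =>
      Submodule.comap_mono (Submodule.torsionBySet_le_torsionBySet_pow i j hij I)⟩
  obtain ⟨c, hc⟩ := monotone_stabilizes_iff_noetherian.2 inferInstance P
  refine ⟨c, fun x hx a => ?_⟩
  obtain ⟨k, hk⟩ := h (g a)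
  have h1 : a ∈ P k := (Submodule.mem_torsionBySet_iff _ _).2 fun y => hk y.2
  have h2 : a ∈ P c := by
    rcases le_total c k with hck | hkc
    · rwa [hc k hck]
    · exact P.monotone hkc h1
  exact (Submodule.mem_torsionBySet_iff _ _).1 h2 ⟨x, hx⟩

/-- Over a Noetherian ring, the `I`-power torsion of an injective module is injective. -/
lemma injective_powTorsion [IsNoetherianRing A] (E : Type u) [AddCommGroup E] [Module A E]
    [Module.Injective A E] : Module.Injective A (powTorsion I E) := by
  refine Module.Baer.injective fun J g => ?_
  obtain ⟨c, hc⟩ := (isPowTorsion_powTorsion (I := I) E).exists_pow_smul_eq_zero g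
  obtain ⟨k, hk⟩ := I.exists_pow_inf_eq_pow_smul (M := A) J
  have hJ : I ^ (k + c) ⊓ J ≤ I ^ c • J := by
    have := hk (k + c) (by lia)
    simp only [smul_eq_mul, Ideal.mul_top, add_tsub_cancel_left] at this
    rw [this, smul_eq_mul]
    exact Ideal.mul_mono_right inf_le_right
  have hg : ∀ a ∈ I ^ c • J, ∀ h : a ∈ J, g ⟨a, h⟩ = 0 := by
    intro a ha
    induction ha using Submodule.smul_induction_on' with
    | smul r hr n hn =>
      intro h
      rw [← hc r hr ⟨n, hn⟩, ← map_smul]; rfl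
    | add x hx y hy h1 h2 =>
      intro h
      have hx' := Submodule.smul_le_right hx
      have hy' := Submodule.smul_le_right hy
      exact (map_add g ⟨x, hx'⟩ ⟨y, hy'⟩).trans (by rw [h1, h2, add_zero])
  let v : J →ₗ[A] A ⧸ I ^ (k + c) := (I ^ (k + c)).mkQ ∘ₗ J.subtype
  have hv : LinearMap.ker v ≤ LinearMap.ker g := by
    intro a ha
    have : (a : A) ∈ I ^ (k + c) := (Submodule.Quotient.mk_eq_zero _).1 ha
    exact hg a (hJ ⟨this, a.2⟩) a.2
  obtain ⟨h, hh⟩ := Module.Injective.out (R := A) (Q := E) ((LinearMap.ker v).liftQ v le_rfl)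
    (LinearMap.ker_eq_bot.1 (Submodule.ker_liftQ_eq_bot _ _ _ le_rfl))
    ((powTorsion I E).subtype ∘ₗ (LinearMap.ker v).liftQ g hv)
  refine ⟨(h ∘ₗ (I ^ (k + c)).mkQ).codRestrict _ fun a => ⟨k + c, fun x hx => ?_⟩, fun a ha => ?_⟩
  · rw [Ideal.mem_torsionOf_iff, ← map_smul, smul_eq_mul]
    have : (I ^ (k + c)).mkQ (x * a) = 0 :=
      (Submodule.Quotient.mk_eq_zero _).2 (Ideal.mul_mem_right _ _ hx)
    rw [LinearMap.comp_apply, this, map_zero]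
  · exact Subtype.ext (hh (Submodule.Quotient.mk ⟨a, ha⟩))

lemma IsPowTorsion.extVanishes_succ [IsNoetherianRing A] {M : ModuleCat.{u} A} (j : ℕ)
    (hM : IsPowTorsion I M) : ExtVanishes I (j + 1) M := by
  induction j using Nat.strong_induction_on generalizing M with | _ j ih
  let E : ModuleCat.{u} A := Injective.under M
  have hE : Module.Injective A E :=
    Module.injective_module_of_injective_object A E (inj := inferInstanceAs (Injective E))
  have hT := injective_powTorsion (I := I) E
  let T : ModuleCat.{u} A := ModuleCat.of A (powTorsion I E)
  have hT' : Injective T := Module.injective_object_of_injective_module A _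
  let f : M →ₗ[A] T := (Injective.ι M).hom.codRestrict _ fun m => by
    obtain ⟨n, hn⟩ := hM m
    refine ⟨n, fun x hx => ?_⟩
    have := hn hx
    rw [Ideal.mem_torsionOf_iff] at this ⊢
    rw [← map_smul, this, map_zero]
  have hf : Function.Injective f := by
    have : Function.Injective (Injective.ι M).hom :=
      (ModuleCat.mono_iff_injective _).1 inferInstance
    exact fun a b hab => this (congrArg Subtype.val hab)
  have hS := LinearMap.shortExact_cokernelShortComplex f hf
  have hQ : IsPowTorsion I (T ⧸ LinearMap.range f) :=
    (isPowTorsion_powTorsion E).of_surjective _ (Submodule.mkQ_surjective _)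
  intro t ξ
  obtain ⟨η, rfl⟩ := Ext.covariant_sequence_exact₁ _ hS ξ (Ext.eq_zero_of_injective _) rfl
  obtain _ | j := j
  · obtain ⟨q, rfl⟩ := Ext.addEquiv₀.symm.surjective η
    obtain ⟨y, hy⟩ := (Submodule.mkQ_surjective (LinearMap.range f))
      (q.hom (Submodule.Quotient.mk (1 : A)))
    obtain ⟨n, hn⟩ := isPowTorsion_powTorsion (I := I) E y
    let r : powQuot I (max t n) ⟶ T := ModuleCat.ofHom
      ((I ^ max t n).liftQ (LinearMap.toSpanSingleton A T y) fun a ha =>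
        hn (Ideal.pow_le_pow_right (le_max_right t n) ha))
    have hr : powQuotMap (le_max_left t n) ≫ q = r ≫ f.cokernelShortComplex.g := by
      ext a
      obtain ⟨a, rfl⟩ := Submodule.mkQ_surjective _ a
      change q.hom (Submodule.Quotient.mk a) = (LinearMap.range f).mkQ (a • y)
      have h1 : (Submodule.Quotient.mk a : A ⧸ I ^ t) = a • Submodule.Quotient.mk (1 : A) := by
        rw [← Submodule.Quotient.mk_smul, smul_eq_mul, mul_one]
      rw [map_smul, hy]
      exact (congrArg q.hom h1).trans (map_smul q.hom a _)
    refine ⟨max t n, le_max_left _ _, ?_⟩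
    change (Ext.mk₀ _).comp ((Ext.mk₀ q).comp _ _) _ = 0
    rw [Ext.mk₀_comp_mk₀_assoc, hr, ← Ext.mk₀_comp_mk₀_assoc, hS.comp_extClass, Ext.comp_zero]
  · exact (ih j (by lia) hQ t η).comp _ _

/-- Every cyclic submodule of `M` has dimension less than `k`. -/
def CyclicDimLT (A : Type*) [CommRing A] (k : ℕ) (M : Type*) [AddCommGroup M] [Module A M] :
    Prop :=
  ∀ m : M, ringKrullDim (A ⧸ Ideal.torsionOf A M m) < k

lemma CyclicDimLT.of_le {k : ℕ} {M N : Type*} [AddCommGroup M] [Module A M]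
    [AddCommGroup N] [Module A N] (h : CyclicDimLT A k M)
    (H : ∀ n : N, ∃ m : M, Ideal.torsionOf A M m ≤ Ideal.torsionOf A N n) : CyclicDimLT A k N := by
  intro n
  obtain ⟨m, hm⟩ := H n
  exact (ringKrullDim_le_of_surjective _ (Ideal.Quotient.factor_surjective hm)).trans_lt (h m)

lemma CyclicDimLT.submodule {k : ℕ} {M : Type*} [AddCommGroup M] [Module A M]
    (h : CyclicDimLT A k M) (N : Submodule A M) : CyclicDimLT A k N :=
  h.of_le fun n => ⟨n, fun x hx => by
    rw [Ideal.mem_torsionOf_iff] at hx ⊢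
    exact Subtype.ext hx⟩

lemma CyclicDimLT.of_surjective {k : ℕ} {M N : Type*} [AddCommGroup M] [Module A M]
    [AddCommGroup N] [Module A N] (h : CyclicDimLT A k M) (f : M →ₗ[A] N)
    (hf : Function.Surjective f) : CyclicDimLT A k N :=
  h.of_le fun n => by
    obtain ⟨m, rfl⟩ := hf n
    refine ⟨m, fun x hx => ?_⟩
    rw [Ideal.mem_torsionOf_iff] at hx ⊢
    rw [← map_smul, hx, map_zero]

lemma CyclicDimLT.quotient_smul {k : ℕ} {M : Type*} [AddCommGroup M] [Module A M]
    (h : CyclicDimLT A (k + 1) M) {x : A} (hx : Function.Injective (LinearMap.lsmul A M x)) :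
    CyclicDimLT A k (M ⧸ LinearMap.range (LinearMap.lsmul A M x)) := by
  intro m
  obtain ⟨m, rfl⟩ := Submodule.mkQ_surjective _ m
  set N := LinearMap.range (LinearMap.lsmul A M x)
  let J := Ideal.torsionOf A M m
  have hle : J ≤ Ideal.torsionOf A (M ⧸ N) (N.mkQ m) := fun a ha => by
    rw [Ideal.mem_torsionOf_iff] at ha ⊢
    rw [← map_smul, ha, map_zero]
  have hreg : Ideal.Quotient.mk J x ∈ nonZeroDivisors (A ⧸ J) := by
    rw [mem_nonZeroDivisors_iff_right]
    intro a ha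
    obtain ⟨a, rfl⟩ := Ideal.Quotient.mk_surjective a
    rw [← map_mul, Ideal.Quotient.eq_zero_iff_mem, Ideal.mem_torsionOf_iff] at ha
    rw [Ideal.Quotient.eq_zero_iff_mem, Ideal.mem_torsionOf_iff]
    apply hx
    rw [LinearMap.lsmul_apply, LinearMap.lsmul_apply, smul_zero, smul_smul, mul_comm, ha]
  have hxm : Ideal.Quotient.factor hle (Ideal.Quotient.mk J x) = 0 := by
    rw [Ideal.Quotient.factor_mk, Ideal.Quotient.eq_zero_iff_mem, Ideal.mem_torsionOf_iff,
      ← map_smul]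
    exact (Submodule.Quotient.mk_eq_zero _).2 ⟨m, rfl⟩
  have h1 := (ringKrullDim_succ_le_of_surjective _ (Ideal.Quotient.factor_surjective hle) hreg
    hxm).trans_lt (h m)
  rw [Nat.cast_succ] at h1
  exact lt_of_add_lt_add_right h1

lemma CyclicDimLT.eq_zero {M : Type*} [AddCommGroup M] [Module A M]
    (h : CyclicDimLT A 0 M) (m : M) : m = 0 := by
  have h1 := h m
  rw [← Ideal.torsionOf_eq_top_iff A]
  by_contra h2
  have := Ideal.Quotient.nontrivial_iff.2 h2
  exact (h1.trans_le ringKrullDim_nonneg_of_nontrivial).false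

/-- If every cyclic submodule of `M` has dimension less than `k`, then the local cohomology of `M`
vanishes in degrees at least `k`. -/
lemma CyclicDimLT.extVanishes [IsNoetherianRing A] {k j : ℕ} (hkj : k ≤ j) {M : ModuleCat.{u} A}
    (hM : CyclicDimLT A k M) : ExtVanishes I j M := by
  induction k generalizing j M with
  | zero =>
    intro t ξ
    have : 𝟙 M = 0 := by
      ext m
      exact hM.eq_zero _
    refine ⟨t, le_rfl, ?_⟩
    rw [← Ext.comp_mk₀_id ξ, this]
    simp
  | succ k ih =>
    obtain ⟨j, rfl⟩ : ∃ i, j = i + 1 := ⟨j - 1, by lia⟩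
    suffices H : ∀ s : Finset A, (s : Set A) ⊆ I → ∀ M : ModuleCat.{u} A, CyclicDimLT A (k + 1) M →
        (∀ m : M, I ≤ (Ideal.torsionOf A M m ⊔ Ideal.span s).radical) → ExtVanishes I (j + 1) M by
      obtain ⟨s, hs⟩ := (isNoetherian_def.1 ‹IsNoetherianRing A›) I
      have hs : Ideal.span (s : Set A) = I := hs
      refine H s (hs ▸ Ideal.subset_span) M hM fun m => ?_
      rw [hs]
      exact le_sup_right.trans Ideal.le_radical
    classical
    intro s
    induction s using Finset.induction_on with
    | empty =>
      intro _ M _ hI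
      refine IsPowTorsion.extVanishes_succ j fun m => ?_
      have := hI m
      rw [Finset.coe_empty, Ideal.span_empty, sup_bot_eq] at this
      exact Ideal.exists_pow_le_of_le_radical_of_fg this (isNoetherian_def.1 ‹IsNoetherianRing A› _)
    | insert x s _ ihs =>
      intro hs M hM hI
      rw [Finset.coe_insert, Set.insert_subset_iff] at hs
      let N := powTorsion (Ideal.span {x}) M
      have hN : ∀ m : N, x ∈ (Ideal.torsionOf A N m).radical := fun m => by
        obtain ⟨n, hn⟩ := isPowTorsion_powTorsion (I := Ideal.span {x}) M m
        exact ⟨n, hn (Ideal.pow_mem_pow (Ideal.mem_span_singleton_self x) n)⟩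
      have hinj : Function.Injective (LinearMap.lsmul A (M ⧸ N) x) := by
        rw [injective_iff_map_eq_zero]
        intro m hm
        obtain ⟨m, rfl⟩ := Submodule.mkQ_surjective _ m
        rw [LinearMap.lsmul_apply, ← map_smul] at hm
        obtain ⟨n, hn⟩ := (Submodule.Quotient.mk_eq_zero _).1 hm
        refine (Submodule.Quotient.mk_eq_zero _).2 ⟨n + 1, ?_⟩
        rw [Ideal.span_singleton_pow, Ideal.span_singleton_le_iff_mem, Ideal.mem_torsionOf_iff]
          at hn ⊢
        rwa [pow_succ, mul_smul]
      have hNI : ∀ m : N, I ≤ (Ideal.torsionOf A N m ⊔ Ideal.span s).radical := fun m => by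
        refine (hI m).trans (Ideal.radical_le_radical_iff.2 ?_)
        rw [Finset.coe_insert, Ideal.span_insert]
        refine sup_le (fun a ha => ?_) (sup_le ?_ (le_sup_right.trans Ideal.le_radical))
        · refine Ideal.le_radical (Ideal.mem_sup_left ?_)
          rw [Ideal.mem_torsionOf_iff] at ha ⊢
          exact Subtype.ext ha
        · rw [Ideal.span_singleton_le_iff_mem]
          exact Ideal.radical_mono le_sup_left (hN m)
      have hQ : CyclicDimLT A (k + 1) (M ⧸ N) := hM.of_surjective _ (Submodule.mkQ_surjective _)
      have hS := LinearMap.shortExact_cokernelShortComplex N.subtype N.injective_subtype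
      refine ExtVanishes.middle hS (ihs hs.2 (ModuleCat.of A N) (hM.submodule N) hNI) ?_
      change ExtVanishes I (j + 1) (ModuleCat.of A (M ⧸ LinearMap.range N.subtype))
      rw [Submodule.range_subtype]
      exact ExtVanishes.succ_of_injective_smul (M := ModuleCat.of A (M ⧸ N)) hs.1 hinj
        (ih (by lia) (M := ModuleCat.of A _) (hQ.quotient_smul hinj))

lemma ExtVanishes.subsingleton_localCohomology {M : ModuleCat.{u} A} {j : ℕ}
    (h : ExtVanishes I (j + 1) M) : Subsingleton ((localCohomology I (j + 1)).obj M) := by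
  let F := diagram (idealPowersDiagram I) (j + 1)
  have := hasColimitDiagram.{u, 0} (idealPowersDiagram I) (j + 1)
  let c := ((evaluation (ModuleCat.{u} A) (ModuleCat.{u} A)).obj M).mapCocone
    (Limits.colimit.cocone F)
  have hc : Limits.IsColimit c := Limits.isColimitOfPreserves _ (Limits.colimit.isColimit F)
  have : Limits.PreservesFilteredColimitsOfSize.{0, 0} (forget (ModuleCat.{u} A)) :=
    Limits.preservesFilteredColimitsOfSize_shrink.{0, u, 0, u} _
  refine subsingleton_of_forall_eq (α := c.pt) 0 fun y => ?_
  obtain ⟨t, e, rfl⟩ := Limits.Concrete.isColimit_exists_rep _ hc y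
  obtain ⟨ξ, hξ⟩ := Abelian.Ext.exists_detects_Ext_map j e
  obtain ⟨s, hs, e0⟩ := h t.unop.unop ξ
  have h0 := hξ _ _ e0
  have hw := congr($(c.w (homOfLE hs).op.op) e)
  rw [← hw]
  refine (congrArg (c.ι.app _) h0).trans (map_zero _)

end localCohomology

theorem local_cohomology_grothendieck_vanishing
    (A : Type) [CommRing A] [IsNoetherianRing A] (I : Ideal A) (d : ℕ)
    (hd : ringKrullDim A ≤ (d : ℕ)) :
    ∀ (M : ModuleCat A) (j : ℕ), d < j → Subsingleton ((localCohomology I j).obj M) := by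
  intro M j hj
  obtain ⟨j, rfl⟩ : ∃ i, j = i + 1 := ⟨j - 1, by lia⟩
  have hM : localCohomology.CyclicDimLT A (d + 1) M := fun m => by
    refine ((ringKrullDim_le_of_surjective _ Ideal.Quotient.mk_surjective).trans hd).trans_lt ?_
    exact_mod_cast d.lt_succ_self
  exact (hM.extVanishes hj).subsingleton_localCohomology
end

section
/- Grothendieck nonvanishing: if (A, m) is a Noetherian local ring of Krull dimension d and M is a finitely generated nonzero A-module of dimension d, then H^d_m(M) ≠ 0. -/
/-!
STATEMENT 13: Grothendieck nonvanishing: if `(A, m)` is a Noetherian local ring of Krull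
dimension `d` and `M` is a finitely generated nonzero `A`-module of dimension `d`
(i.e. `dim A/ann M = d`), then `H^d_m(M) ≠ 0`.
-/

open CategoryTheory

noncomputable section

open Limits

universe u

lemma HomologicalComplex.homologyUnop_hom_naturality {ι V : Type*} [Category* V] [Abelian V]
    {c : ComplexShape ι} {K L : HomologicalComplex Vᵒᵖ c} (ψ : K ⟶ L) (i : ι) :
    homologyMap ((unopFunctor V c).map ψ.op) i ≫ (K.homologyUnop i).hom =
      (L.homologyUnop i).hom ≫ (homologyMap ψ i).unop := by
  apply Quiver.Hom.op_inj
  exact (homologyOp_hom_naturality ((unopFunctor V c).map ψ.op) i).symm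

lemma CategoryTheory.Iso.conj_naturality {V : Type*} [Category* V] {L L' M M' N N' : V}
    (i : L ≅ M) (i' : L' ≅ M') (j : N ≅ M) (j' : N' ≅ M') {f : L ⟶ L'} {m : M ⟶ M'} {k : N ⟶ N'}
    (h₁ : f = i.hom ≫ m ≫ i'.inv) (h₂ : k ≫ j'.hom = j.hom ≫ m) :
    f ≫ (i' ≪≫ j'.symm).hom = (i ≪≫ j.symm).hom ≫ k := by
  have : k = j.hom ≫ m ≫ j'.inv := by rw [← Category.assoc, ← h₂]; simp
  simp [h₁, this]

namespace ExtModule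

variable {A : Type u} [CommRing A]

/-- The cochain complex `Hom(P, Y)`. -/
abbrev cochains (P : ChainComplex (ModuleCat.{u} A) ℕ) (Y : ModuleCat.{u} A) :
    CochainComplex (ModuleCat.{u} A) ℕ := P.linearYonedaObj A Y

/-- Functoriality of `Hom(P, Y)` in `Y`. -/
def cochainsMap (P : ChainComplex (ModuleCat.{u} A) ℕ) {Y Y' : ModuleCat.{u} A} (g : Y ⟶ Y') :
    cochains P Y ⟶ cochains P Y' where
  f i := ModuleCat.ofHom (Linear.rightComp A (P.X i) g)
  comm' i j _ := by
    ext x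
    exact Category.assoc (P.d j i) (x : P.X i ⟶ Y) g |>.symm

/-- Functoriality of `Hom(P, Y)` in `P`. -/
def cochainsPrecomp {P P' : ChainComplex (ModuleCat.{u} A) ℕ} (φ : P ⟶ P')
    (Y : ModuleCat.{u} A) : cochains P' Y ⟶ cochains P Y where
  f i := ModuleCat.ofHom (Linear.leftComp A Y (φ.f i))
  comm' i j _ := by
    ext (x : P'.X i ⟶ Y)
    exact (Category.assoc _ _ x).symm.trans
      ((congrArg (· ≫ x) (φ.comm j i).symm).trans (Category.assoc _ _ x))

lemma isoExt_naturality {X : ModuleCat.{u} A} (P : ProjectiveResolution X) (n : ℕ)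
    {Y Y' : ModuleCat.{u} A} (g : Y ⟶ Y') :
    ((Ext A (ModuleCat.{u} A) n).obj (.op X)).map g ≫ (P.isoExt n Y').hom =
      (P.isoExt n Y).hom ≫ HomologicalComplex.homologyMap (cochainsMap P.complex g) n := by
  have h := congrArg Quiver.Hom.unop (P.leftDerived_app_eq
    (((linearYoneda A (ModuleCat.{u} A)).map g).rightOp) n)
  refine Iso.conj_naturality _ _ _ _ (h.trans ?_)
    (HomologicalComplex.homologyUnop_hom_naturality
    ((NatTrans.mapHomologicalComplex (((linearYoneda A (ModuleCat.{u} A)).map g).rightOp) _).app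
      P.complex) n)
  exact Category.assoc _ _ _

lemma isoExt_naturality_left {X X' : ModuleCat.{u} A} (P : ProjectiveResolution X)
    (P' : ProjectiveResolution X') (f : X ⟶ X') (φ : P.complex ⟶ P'.complex)
    (comm : φ.f 0 ≫ P'.π.f 0 = P.π.f 0 ≫ f) (n : ℕ) (Y : ModuleCat.{u} A) :
    ((Ext A (ModuleCat.{u} A) n).map f.op).app Y ≫ (P.isoExt n Y).hom =
      (P'.isoExt n Y).hom ≫ HomologicalComplex.homologyMap (cochainsPrecomp φ Y) n := by
  have h := congrArg Quiver.Hom.unop ((Iso.inv_comp_eq _).mp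
    (P.isoLeftDerivedObj_inv_naturality f P' φ comm
    ((linearYoneda A (ModuleCat.{u} A)).obj Y).rightOp n))
  refine Iso.conj_naturality _ _ _ _ (h.trans ?_) (HomologicalComplex.homologyUnop_hom_naturality
    (((((linearYoneda A (ModuleCat.{u} A)).obj Y).rightOp).mapHomologicalComplex _).map φ) n)
  exact Category.assoc _ _ _

end ExtModule

lemma CategoryTheory.Iso.connecting_naturality_aux {V : Type*} [Category* V]
    {L L' M M' N N' K K' : V} (a : L ≅ M) (a' : L' ≅ M') (b : N ≅ K) (b' : N' ≅ K')
    {f : L' ⟶ L} {φ : M' ⟶ M} {g : N' ⟶ N} {ψ : K' ⟶ K} {δ : M ⟶ K} {δ' : M' ⟶ K'}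
    (h₁ : f ≫ a.hom = a'.hom ≫ φ) (h₂ : g ≫ b.hom = b'.hom ≫ ψ) (h : δ' ≫ ψ = φ ≫ δ) :
    f ≫ a.hom ≫ δ ≫ b.inv = (a'.hom ≫ δ' ≫ b'.inv) ≫ g := by
  rw [← cancel_mono b.hom, ← Category.assoc f, h₁]
  simp [h₂, h]

lemma ModuleCat.function_exact_of_iso {R : Type*} [Ring R] {X₁ X₂ X₃ : ModuleCat R}
    {f : X₁ ⟶ X₂} {g : X₂ ⟶ X₃} (T : ShortComplex (ModuleCat R)) (hT : T.Exact)
    (e₁ : X₁ ≅ T.X₁) (e₂ : X₂ ≅ T.X₂) (e₃ : X₃ ≅ T.X₃)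
    (hf : f ≫ e₂.hom = e₁.hom ≫ T.f) (hg : g ≫ e₃.hom = e₂.hom ≫ T.g) : Function.Exact f g := by
  have w : f ≫ g = 0 := by
    rw [← cancel_mono e₃.hom, Category.assoc, hg, ← Category.assoc, hf, Category.assoc, T.zero]
    simp
  have h : (ShortComplex.mk f g w).Exact :=
    (ShortComplex.exact_iff_of_iso (ShortComplex.isoMk e₁ e₂ e₃ hf.symm hg.symm)).mpr hT
  exact (ShortComplex.ShortExact.moduleCat_exact_iff_function_exact _).mp h

namespace ExtModule

variable {A : Type u} [CommRing A]

/-- The short complex of cochain complexes `Hom(P, S)`. -/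
def cochainsShortComplex (P : ChainComplex (ModuleCat.{u} A) ℕ)
    (S : ShortComplex (ModuleCat.{u} A)) : ShortComplex (CochainComplex (ModuleCat.{u} A) ℕ) :=
  ShortComplex.mk (cochainsMap P S.f) (cochainsMap P S.g) (by
    ext i (x : P.X i ⟶ S.X₁)
    exact (Category.assoc x _ _).trans ((congrArg (x ≫ ·) S.zero).trans comp_zero))

lemma cochainsShortComplex_shortExact {X : ModuleCat.{u} A} (P : ProjectiveResolution X)
    {S : ShortComplex (ModuleCat.{u} A)} (hS : S.ShortExact) :
    (cochainsShortComplex P.complex S).ShortExact := by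
  have := hS.mono_f
  have := hS.epi_g
  refine HomologicalComplex.shortExact_of_degreewise_shortExact _ fun i ↦ ?_
  refine { exact := ?_, mono_f := ?_, epi_g := ?_ }
  · rw [ShortComplex.moduleCat_exact_iff]
    intro (x : P.complex.X i ⟶ S.X₂) (hx : x ≫ S.g = 0)
    exact ⟨hS.exact.lift x hx, hS.exact.lift_f x hx⟩
  · rw [ModuleCat.mono_iff_injective]
    intro (x : P.complex.X i ⟶ S.X₁) (y : P.complex.X i ⟶ S.X₁) (h : x ≫ S.f = y ≫ S.f)
    exact (cancel_mono _).mp h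
  · rw [ModuleCat.epi_iff_surjective]
    intro (x : P.complex.X i ⟶ S.X₃)
    exact ⟨Projective.factorThru x S.g, Projective.factorThru_comp x S.g⟩

/-- Functoriality of `Hom(P, S)` in `P`. -/
def cochainsShortComplexPrecomp {P P' : ChainComplex (ModuleCat.{u} A) ℕ} (φ : P ⟶ P')
    (S : ShortComplex (ModuleCat.{u} A)) :
    cochainsShortComplex P' S ⟶ cochainsShortComplex P S where
  τ₁ := cochainsPrecomp φ S.X₁
  τ₂ := cochainsPrecomp φ S.X₂
  τ₃ := cochainsPrecomp φ S.X₃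
  comm₁₂ := by
    ext i (x : P'.X i ⟶ S.X₁)
    exact Category.assoc _ x _
  comm₂₃ := by
    ext i (x : P'.X i ⟶ S.X₂)
    exact Category.assoc _ x _

/-- A chosen projective resolution of a module. -/
def resolution (X : ModuleCat.{u} A) : ProjectiveResolution X := projectiveResolution X

/-- The connecting homomorphism of `Ext(X, -)` for a short exact sequence. -/
def connecting {S : ShortComplex (ModuleCat.{u} A)} (hS : S.ShortExact) (n : ℕ)
    (X : ModuleCat.{u} A) :
    ((Ext A (ModuleCat.{u} A) n).obj (.op X)).obj S.X₃ ⟶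
      ((Ext A (ModuleCat.{u} A) (n + 1)).obj (.op X)).obj S.X₁ :=
  ((resolution X).isoExt n S.X₃).hom ≫
    (cochainsShortComplex_shortExact (resolution X) hS).δ n (n + 1) rfl ≫
      ((resolution X).isoExt (n + 1) S.X₁).inv

lemma connecting_naturality {S : ShortComplex (ModuleCat.{u} A)} (hS : S.ShortExact) (n : ℕ)
    {X X' : ModuleCat.{u} A} (f : X ⟶ X') :
    ((Ext A (ModuleCat.{u} A) n).map f.op).app S.X₃ ≫ connecting hS n X =
      connecting hS n X' ≫ ((Ext A (ModuleCat.{u} A) (n + 1)).map f.op).app S.X₁ := by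
  set P := resolution X
  set P' := resolution X'
  let φ := ProjectiveResolution.lift f P P'
  have comm := ProjectiveResolution.lift_commutes_zero f P P'
  exact (Iso.connecting_naturality_aux _ _ _ _
    (isoExt_naturality_left P P' f φ comm n S.X₃)
    (isoExt_naturality_left P P' f φ comm (n + 1) S.X₁)
    (HomologicalComplex.HomologySequence.δ_naturality
    (cochainsShortComplexPrecomp φ S) (cochainsShortComplex_shortExact P' hS)
    (cochainsShortComplex_shortExact P hS) n (n + 1) rfl))

lemma ext_exact₂ {S : ShortComplex (ModuleCat.{u} A)} (hS : S.ShortExact) (n : ℕ)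
    (X : ModuleCat.{u} A) : Function.Exact (((Ext A (ModuleCat.{u} A) n).obj (.op X)).map S.f)
    (((Ext A (ModuleCat.{u} A) n).obj (.op X)).map S.g) :=
  ModuleCat.function_exact_of_iso _
    ((cochainsShortComplex_shortExact (resolution X) hS).homology_exact₂ n)
    _ _ _ (isoExt_naturality _ n S.f) (isoExt_naturality _ n S.g)

variable {S : ShortComplex (ModuleCat.{u} A)} (hS : S.ShortExact) (n : ℕ) (X : ModuleCat.{u} A)

lemma connecting_comp_isoExt_hom : connecting hS n X ≫ ((resolution X).isoExt (n + 1) S.X₁).hom =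
    ((resolution X).isoExt n S.X₃).hom ≫
    (cochainsShortComplex_shortExact (resolution X) hS).δ n (n + 1) rfl :=
  (Iso.eq_comp_inv _).mp (Category.assoc _ _ _).symm

lemma ext_exact₃ : Function.Exact (((Ext A (ModuleCat.{u} A) n).obj (.op X)).map S.g)
    (connecting hS n X) :=
  ModuleCat.function_exact_of_iso _
    ((cochainsShortComplex_shortExact (resolution X) hS).homology_exact₃ n (n + 1) rfl)
    _ _ _ (isoExt_naturality _ n S.g) (connecting_comp_isoExt_hom hS n X)

lemma ext_exact₁ : Function.Exact (connecting hS n X)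
    (((Ext A (ModuleCat.{u} A) (n + 1)).obj (.op X)).map S.f) :=
  ModuleCat.function_exact_of_iso _
    ((cochainsShortComplex_shortExact (resolution X) hS).homology_exact₁ n (n + 1) rfl)
    _ _ _ (connecting_comp_isoExt_hom hS n X) (isoExt_naturality _ (n + 1) S.f)

end ExtModule

lemma CategoryTheory.Iso.eq_smul_id {R V : Type*} [Ring R] [Category* V] [Preadditive V]
    [Linear R V] {L M : V} (a : L ≅ M) {f : L ⟶ L} (r : R) (h : f ≫ a.hom = a.hom ≫ (r • 𝟙 M)) :
    f = r • 𝟙 L := by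
  rw [← cancel_mono a.hom, h]
  simp

lemma HomologicalComplex.homologyMap_smul_id {R V ι : Type*} [Ring R] [Category* V] [Abelian V]
    [Linear R V] {c : ComplexShape ι} (K : HomologicalComplex V c) (i : ι) (r : R) :
    homologyMap (r • 𝟙 K) i = r • 𝟙 (K.homology i) := by
  refine (ShortComplex.homologyMap_smul
    ((HomologicalComplex.shortComplexFunctor V c i).map (𝟙 K)) r).trans ?_
  exact congrArg (r • ·) (homologyMap_id K i)

lemma CategoryTheory.Iso.lift_naturality_aux {V : Type*} [Category* V]
    {C C' H H' E E' N N' : V} (a : E ≅ H) (a' : E' ≅ H') (b : C ≅ H) (b' : C' ≅ H')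
    {m : E ⟶ E'} {h : H ⟶ H'} {c : C ⟶ C'} {k : N ⟶ N'}
    (h₁ : m ≫ a'.hom = a.hom ≫ h) (h₂ : h ≫ b'.inv = b.inv ≫ c) (l : N ⟶ C) (l' : N' ⟶ C')
    (h₃ : l ≫ c = k ≫ l') :
    (l ≫ b.hom ≫ a.inv) ≫ m = k ≫ l' ≫ b'.hom ≫ a'.inv := by
  have e₁ : a.inv ≫ m = h ≫ a'.inv := by rw [Iso.inv_comp_eq, ← Category.assoc, ← h₁]; simp
  have e₂ : b.hom ≫ h = c ≫ b'.hom := by rw [← Iso.eq_inv_comp, ← Category.assoc, ← h₂]; simp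
  rw [← reassoc_of% h₃, ← reassoc_of% e₂, ← e₁]
  simp

namespace ExtModule

variable {A : Type u} [CommRing A]

lemma ext_map_smul_id (n : ℕ) (X Y : ModuleCat.{u} A) (r : A) :
    ((Ext A (ModuleCat.{u} A) n).obj (.op X)).map (r • 𝟙 Y) = r • 𝟙 _ := by
  have h : cochainsMap (resolution X).complex (r • 𝟙 Y) = r • 𝟙 _ := by
    ext i (x : (resolution X).complex.X i ⟶ Y)
    exact (Linear.comp_smul _ _ _ x r (𝟙 Y)).trans (congrArg (r • ·) (Category.comp_id x))
  refine Iso.eq_smul_id ((resolution X).isoExt n Y) r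
    ((isoExt_naturality (resolution X) n (r • 𝟙 Y)).trans ?_)
  exact congrArg (_ ≫ ·) ((congrArg (HomologicalComplex.homologyMap · n) h).trans
    (HomologicalComplex.homologyMap_smul_id _ _ _))

lemma ext_map_op_smul_id (n : ℕ) (X Y : ModuleCat.{u} A) (r : A) :
    ((Ext A (ModuleCat.{u} A) n).map (r • 𝟙 X).op).app Y = r • 𝟙 _ := by
  have h : cochainsPrecomp (r • 𝟙 (resolution X).complex) Y = r • 𝟙 _ := by
    ext i (x : (resolution X).complex.X i ⟶ Y)
    exact (Linear.smul_comp _ _ _ r (𝟙 _) x).trans (congrArg (r • ·) (Category.id_comp x))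
  refine Iso.eq_smul_id ((resolution X).isoExt n Y) r
    ((isoExt_naturality_left (resolution X) (resolution X) (r • 𝟙 X) (r • 𝟙 _) ?_ n Y).trans ?_)
  · refine (Linear.smul_comp _ _ _ r (𝟙 _) _).trans ?_
    refine Eq.trans ?_ (Linear.comp_smul _ _ _ _ r (𝟙 _)).symm
    exact congrArg (r • ·) ((Category.id_comp _).trans (Category.comp_id _).symm)
  · exact congrArg (_ ≫ ·) ((congrArg (HomologicalComplex.homologyMap · n) h).trans
      (HomologicalComplex.homologyMap_smul_id _ _ _))

lemma smul_ext_eq_zero (n : ℕ) (X Y : ModuleCat.{u} A) {r : A} (hr : r • 𝟙 X = 0)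
    (e : ((Ext A (ModuleCat.{u} A) n).obj (.op X)).obj Y) : r • e = 0 := by
  have h₀ : r • 𝟙 X = (0 : A) • 𝟙 X := by rw [hr, zero_smul]
  have h := (ext_map_op_smul_id n X Y r).symm.trans
    ((congrArg (fun f ↦ ((Ext A (ModuleCat.{u} A) n).map (Quiver.Hom.op f)).app Y) h₀).trans
      (ext_map_op_smul_id n X Y 0))
  exact (congrArg (fun f ↦ f.hom e) h).trans (zero_smul A e)

lemma ext_succ_subsingleton_of_injective (n : ℕ) (X I : ModuleCat.{u} A) [Injective I] :
    Subsingleton (((Ext A (ModuleCat.{u} A) (n + 1)).obj (.op X)).obj I) := by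
  have hP := (resolution X).complex_exactAt_succ n
  have h : (cochains (resolution X).complex I).ExactAt (n + 1) := by
    rw [HomologicalComplex.exactAt_iff' _ n (n + 1) (n + 2) (by simp) (by simp)]
    rw [HomologicalComplex.exactAt_iff' _ (n + 2) (n + 1) n (by simp) (by simp)] at hP
    rw [ShortComplex.moduleCat_exact_iff]
    intro (x : (resolution X).complex.X (n + 1) ⟶ I)
      (hx : (resolution X).complex.d (n + 2) (n + 1) ≫ x = 0)
    exact ⟨hP.descToInjective x hx, hP.comp_descToInjective x hx⟩
  rw [HomologicalComplex.exactAt_iff_isZero_homology] at h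
  exact ModuleCat.subsingleton_of_isZero (h.of_iso ((resolution X).isoExt (n + 1) I))

/-- The map `Hom(X, Y) ⟶ Hom(P₀, Y)` induced by a projective resolution `P` of `X`. -/
def augmentation {X : ModuleCat.{u} A} (P : ProjectiveResolution X) (Y : ModuleCat.{u} A) :
    ModuleCat.of A (X ⟶ Y) ⟶ (cochains P.complex Y).X 0 :=
  ModuleCat.ofHom (Linear.leftComp A Y (P.π.f 0))

lemma augmentation_d {X : ModuleCat.{u} A} (P : ProjectiveResolution X) (Y : ModuleCat.{u} A) :
    augmentation P Y ≫ (cochains P.complex Y).d 0 1 = 0 := by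
  ext (x : X ⟶ Y)
  exact (Category.assoc _ _ x).symm.trans
    ((congrArg (· ≫ x) P.complex_d_comp_π_f_zero).trans zero_comp)

/-- The natural map `Hom(X, Y) ⟶ Ext⁰(X, Y)`. -/
def homToExt {X : ModuleCat.{u} A} (P : ProjectiveResolution X) (Y : ModuleCat.{u} A) :
    ModuleCat.of A (X ⟶ Y) ⟶ ((Ext A (ModuleCat.{u} A) 0).obj (.op X)).obj Y :=
  (cochains P.complex Y).liftCycles (augmentation P Y) 1 (by simp) (augmentation_d P Y) ≫
    (cochains P.complex Y).isoHomologyπ₀.hom ≫ (P.isoExt 0 Y).inv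

lemma homToExt_bijective (X : ModuleCat.{u} A) (Y : ModuleCat.{u} A) :
    Function.Bijective (homToExt (resolution X) Y) := by
  set P := resolution X
  have hlift := (cochains P.complex Y).liftCycles_i (augmentation P Y) 1 (by simp)
    (augmentation_d P Y)
  have hmono : Mono (augmentation P Y) := by
    rw [ModuleCat.mono_iff_injective]
    intro (x : X ⟶ Y) (y : X ⟶ Y) (h : P.π.f 0 ≫ x = P.π.f 0 ≫ y)
    exact (cancel_epi (P.π.f 0)).mp h
  have : IsIso ((cochains P.complex Y).liftCycles (augmentation P Y) 1 (by simp)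
      (augmentation_d P Y)) := by
    rw [ConcreteCategory.isIso_iff_bijective]
    constructor
    · rw [← ModuleCat.mono_iff_injective]
      exact mono_of_mono_fac hlift
    · intro z
      have hz : P.complex.d 1 0 ≫ (show P.complex.X 0 ⟶ Y from
        (cochains P.complex Y).iCycles 0 z) = 0 :=
        congrArg (fun f ↦ f.hom z) ((cochains P.complex Y).iCycles_d 0 1)
      let c : CokernelCofork (P.complex.d 1 0) := CokernelCofork.ofπ _ hz
      refine ⟨P.isColimitCokernelCofork.desc c, ?_⟩
      refine (ModuleCat.mono_iff_injective ((cochains P.complex Y).iCycles 0)).mp inferInstance ?_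
      exact (congrArg (fun f ↦ f.hom (P.isColimitCokernelCofork.desc c)) hlift).trans
        (P.isColimitCokernelCofork.fac c WalkingParallelPair.one)
  have : IsIso (homToExt P Y) := by unfold homToExt; infer_instance
  exact ConcreteCategory.bijective_of_isIso _

lemma homToExt_naturality {X : ModuleCat.{u} A} (P : ProjectiveResolution X)
    {Y Y' : ModuleCat.{u} A} (g : Y ⟶ Y') :
    homToExt P Y ≫ ((Ext A (ModuleCat.{u} A) 0).obj (.op X)).map g =
      ModuleCat.ofHom (Linear.rightComp A X g) ≫ homToExt P Y' := by
  refine Iso.lift_naturality_aux _ _ _ _ (isoExt_naturality P 0 g)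
    (CochainComplex.isoHomologyπ₀_inv_naturality (cochainsMap P.complex g)) _ _ ?_
  rw [← cancel_mono ((cochains P.complex Y').iCycles 0), Category.assoc, Category.assoc]
  refine (congrArg (_ ≫ ·) (HomologicalComplex.cyclesMap_i (cochainsMap P.complex g) 0)).trans ?_
  refine (Category.assoc _ _ _).symm.trans ?_
  refine (congrArg (· ≫ _) ((cochains P.complex Y).liftCycles_i _ 1 _ _)).trans ?_
  refine Eq.trans ?_ (congrArg (_ ≫ ·) ((cochains P.complex Y').liftCycles_i _ 1 _ _)).symm
  ext (x : X ⟶ Y)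
  exact Category.assoc _ x g

lemma homToExt_naturality_left {X X' : ModuleCat.{u} A} (f : X ⟶ X') (Y : ModuleCat.{u} A) :
    homToExt (resolution X') Y ≫ ((Ext A (ModuleCat.{u} A) 0).map f.op).app Y =
      ModuleCat.ofHom (Linear.leftComp A Y f) ≫ homToExt (resolution X) Y := by
  set P := resolution X
  set P' := resolution X'
  let φ := ProjectiveResolution.lift f P P'
  have comm := ProjectiveResolution.lift_commutes_zero f P P'
  refine Iso.lift_naturality_aux _ _ _ _ (isoExt_naturality_left P P' f φ comm 0 Y)
    (CochainComplex.isoHomologyπ₀_inv_naturality (cochainsPrecomp φ Y)) _ _ ?_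
  rw [← cancel_mono ((cochains P.complex Y).iCycles 0), Category.assoc, Category.assoc]
  refine (congrArg (_ ≫ ·) (HomologicalComplex.cyclesMap_i (cochainsPrecomp φ Y) 0)).trans ?_
  refine (Category.assoc _ _ _).symm.trans ?_
  refine (congrArg (· ≫ _) ((cochains P'.complex Y).liftCycles_i _ 1 _ _)).trans ?_
  refine Eq.trans ?_ (congrArg (_ ≫ ·) ((cochains P.complex Y).liftCycles_i _ 1 _ _)).symm
  ext (x : X' ⟶ Y)
  exact (Category.assoc _ _ x).symm.trans ((congrArg (· ≫ x) comm).trans (Category.assoc _ _ x))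

end ExtModule

namespace localCohomology

open ExtModule Opposite

variable {A : Type u} [CommRing A] (J : Ideal A)

/-- The module `A ⧸ J ^ t`. -/
abbrev powQuotient (t : ℕ) : ModuleCat.{u} A := (ringModIdeals (idealPowersDiagram J)).obj (op t)

/-- The projection `A ⧸ J ^ t ⟶ A ⧸ J ^ s` for `s ≤ t`. -/
def powQuotientMap {s t : ℕ} (h : s ≤ t) : powQuotient J t ⟶ powQuotient J s :=
  (ringModIdeals (idealPowersDiagram J)).map (homOfLE h).op

/-- The functor `Extⁿ(A ⧸ J ^ t, -)`. -/
abbrev extPow (n t : ℕ) : ModuleCat.{u} A ⥤ ModuleCat.{u} A :=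
  (Ext A (ModuleCat.{u} A) n).obj (op (powQuotient J t))

/-- The transition map `Extⁿ(A ⧸ J ^ s, -) ⟶ Extⁿ(A ⧸ J ^ t, -)` for `s ≤ t`. -/
def extPowMap (n : ℕ) {s t : ℕ} (h : s ≤ t) : extPow J n s ⟶ extPow J n t :=
  (Ext A (ModuleCat.{u} A) n).map (powQuotientMap J h).op

/-- The map from `Extⁿ(A ⧸ J ^ t, -)` to local cohomology. -/
def fromExt (n t : ℕ) : extPow J n t ⟶ localCohomology J n :=
  colimit.ι (diagram (idealPowersDiagram J) n) (op (op t))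

lemma extPowMap_fromExt (n : ℕ) {s t : ℕ} (h : s ≤ t) :
    extPowMap J n h ≫ fromExt J n t = fromExt J n s :=
  colimit.w (diagram (idealPowersDiagram J) n) (homOfLE h).op.op

/-- Local cohomology of `Y` is the colimit of the modules `Extⁿ(A ⧸ J ^ t, Y)`. -/
def isColimitEval (n : ℕ) (Y : ModuleCat.{u} A) :
    IsColimit (((evaluation _ _).obj Y).mapCocone
      (colimit.cocone (diagram (idealPowersDiagram J) n))) :=
  isColimitOfPreserves _ (colimit.isColimit _)

variable {J}

lemma exists_fromExt {n : ℕ} {Y : ModuleCat.{u} A} (h : (localCohomology J n).obj Y) :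
    ∃ (t : ℕ) (e : (extPow J n t).obj Y), (fromExt J n t).app Y e = h := by
  have := preservesFilteredColimitsOfSize_shrink.{0, u, 0, u} (forget (ModuleCat.{u} A))
  obtain ⟨t, e, he⟩ := Concrete.isColimit_exists_rep _ (isColimitEval J n Y) h
  exact ⟨t.unop.unop, e, he⟩

lemma fromExt_eq_zero {n t : ℕ} {Y : ModuleCat.{u} A} {e : (extPow J n t).obj Y}
    (he : (fromExt J n t).app Y e = 0) :
    ∃ (s : ℕ) (h : t ≤ s), (extPowMap J n h).app Y e = 0 := by
  have := preservesFilteredColimitsOfSize_shrink.{0, u, 0, u} (forget (ModuleCat.{u} A))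
  obtain ⟨s, f, g, h⟩ := Concrete.isColimit_exists_of_rep_eq (i := op (op t)) (j := op (op t)) _
    (isColimitEval J n Y) e 0 (he.trans (map_zero ((fromExt J n t).app Y).hom).symm)
  exact ⟨s.unop.unop, leOfHom f.unop.unop, h.trans (map_zero (ModuleCat.Hom.hom _))⟩

lemma exists_hom_of_compatible {n : ℕ} {Y Z : ModuleCat.{u} A}
    (φ : ∀ t, (extPow J n t).obj Y ⟶ Z)
    (hφ : ∀ s t (h : s ≤ t), (extPowMap J n h).app Y ≫ φ t = φ s) :
    ∃ f : (localCohomology J n).obj Y ⟶ Z, ∀ t, (fromExt J n t).app Y ≫ f = φ t := by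
  let c : Cocone (diagram (idealPowersDiagram J) n ⋙ (evaluation _ _).obj Y) :=
    { pt := Z
      ι :=
        { app t := φ t.unop.unop
          naturality s t f := (hφ _ _ (leOfHom f.unop.unop)).trans (Category.comp_id _).symm } }
  exact ⟨(isColimitEval J n Y).desc c, fun t ↦ (isColimitEval J n Y).fac c (op (op t))⟩

lemma hom_ext {n : ℕ} {Y Z : ModuleCat.{u} A} {f g : (localCohomology J n).obj Y ⟶ Z}
    (h : ∀ t, (fromExt J n t).app Y ≫ f = (fromExt J n t).app Y ≫ g) : f = g :=
  (isColimitEval J n Y).hom_ext fun t ↦ h t.unop.unop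

end localCohomology

namespace localCohomology

open ExtModule Opposite

variable {A : Type u} [CommRing A] {J : Ideal A}

lemma comp_inv_comp_eq {V : Type*} [Category* V] {C C' E E' Y : V} {a : C ⟶ E} {b : C' ⟶ E'}
    [IsIso a] [IsIso b] {m : E ⟶ E'} {l : C ⟶ C'} {p : C ⟶ Y} {p' : C' ⟶ Y}
    (h : a ≫ m = l ≫ b) (hp : l ≫ p' = p) : m ≫ inv b ≫ p' = inv a ≫ p := by
  rw [IsIso.eq_inv_comp, ← Category.assoc, h]
  simp [hp]

lemma comp_apply_eq {X Y Y' Z : ModuleCat.{u} A} {f : X ⟶ Y} {g : Y ⟶ Z} {f' : X ⟶ Y'}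
    {g' : Y' ⟶ Z} (h : f ≫ g = f' ≫ g') (x : X) : g (f x) = g' (f' x) :=
  congrArg (fun k ↦ k.hom x) h

lemma exact_of_exact {n₁ n₂ n₃ : ℕ} {Y₁ Y₂ Y₃ : ModuleCat.{u} A}
    {f : (localCohomology J n₁).obj Y₁ ⟶ (localCohomology J n₂).obj Y₂}
    {g : (localCohomology J n₂).obj Y₂ ⟶ (localCohomology J n₃).obj Y₃}
    (f' : ∀ t, (extPow J n₁ t).obj Y₁ ⟶ (extPow J n₂ t).obj Y₂)
    (g' : ∀ t, (extPow J n₂ t).obj Y₂ ⟶ (extPow J n₃ t).obj Y₃)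
    (hf : ∀ t, (fromExt J n₁ t).app Y₁ ≫ f = f' t ≫ (fromExt J n₂ t).app Y₂)
    (hg : ∀ t, (fromExt J n₂ t).app Y₂ ≫ g = g' t ≫ (fromExt J n₃ t).app Y₃)
    (hg' : ∀ s t (h : s ≤ t),
      (extPowMap J n₂ h).app Y₂ ≫ g' t = g' s ≫ (extPowMap J n₃ h).app Y₃)
    (hex : ∀ t, Function.Exact (f' t) (g' t)) : Function.Exact f g := by
  intro x
  constructor
  · intro hx
    obtain ⟨t, e, rfl⟩ := exists_fromExt x
    rw [comp_apply_eq (hg t)] at hx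
    obtain ⟨s, h, hs⟩ := fromExt_eq_zero hx
    rw [← comp_apply_eq (hg' t s h)] at hs
    obtain ⟨y, hy⟩ := (hex s _).mp hs
    refine ⟨(fromExt J n₁ s).app Y₁ y, ?_⟩
    rw [comp_apply_eq (hf s), hy]
    exact congrArg (fun k ↦ (k.app Y₂).hom e) (extPowMap_fromExt J n₂ h)
  · rintro ⟨y, rfl⟩
    obtain ⟨t, e, rfl⟩ := exists_fromExt y
    rw [comp_apply_eq (hf t), comp_apply_eq (hg t), (hex t).apply_apply_eq_zero]
    exact map_zero ((fromExt J n₃ t).app Y₃).hom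

variable (J) in
lemma map_exact {S : ShortComplex (ModuleCat.{u} A)} (hS : S.ShortExact) (n : ℕ) :
    Function.Exact ((localCohomology J n).map S.f) ((localCohomology J n).map S.g) :=
  exact_of_exact (fun t ↦ (extPow J n t).map S.f) (fun t ↦ (extPow J n t).map S.g)
    (fun t ↦ ((fromExt J n t).naturality S.f).symm) (fun t ↦ ((fromExt J n t).naturality S.g).symm)
    (fun _ _ h ↦ ((extPowMap J n h).naturality S.g).symm) (fun _ ↦ ext_exact₂ hS n _)

variable (J) in
lemma exists_connecting {S : ShortComplex (ModuleCat.{u} A)} (hS : S.ShortExact) (n : ℕ) :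
    ∃ δ : (localCohomology J n).obj S.X₃ ⟶ (localCohomology J (n + 1)).obj S.X₁,
      Function.Exact ((localCohomology J n).map S.g) δ ∧
      Function.Exact δ ((localCohomology J (n + 1)).map S.f) := by
  obtain ⟨δ, hδ⟩ := exists_hom_of_compatible
    (fun t ↦ connecting hS n (powQuotient J t) ≫ (fromExt J (n + 1) t).app S.X₁) (fun s t h ↦ by
      refine (Category.assoc _ _ _).symm.trans ?_
      refine (congrArg (· ≫ _) (connecting_naturality hS n (powQuotientMap J h))).trans ?_
      refine (Category.assoc _ _ _).trans (congrArg (_ ≫ ·) ?_)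
      exact congrArg (fun k ↦ k.app S.X₁) (extPowMap_fromExt J (n + 1) h))
  refine ⟨δ, ?_, ?_⟩
  · exact exact_of_exact (fun t ↦ (extPow J n t).map S.g) (fun t ↦ connecting hS n _)
      (fun t ↦ ((fromExt J n t).naturality S.g).symm) hδ
      (fun _ _ h ↦ connecting_naturality hS n (powQuotientMap J h)) (fun t ↦ ext_exact₃ hS n _)
  · exact exact_of_exact (fun t ↦ connecting hS n _) (fun t ↦ (extPow J (n + 1) t).map S.f)
      hδ (fun t ↦ ((fromExt J (n + 1) t).naturality S.f).symm)
      (fun _ _ h ↦ ((extPowMap J (n + 1) h).naturality S.f).symm) (fun t ↦ ext_exact₁ hS n _)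

lemma map_smul_id (n : ℕ) (Y : ModuleCat.{u} A) (r : A) (x : (localCohomology J n).obj Y) :
    (localCohomology J n).map (r • 𝟙 Y) x = r • x := by
  obtain ⟨t, e, rfl⟩ := exists_fromExt x
  rw [comp_apply_eq ((fromExt J n t).naturality (r • 𝟙 Y)).symm]
  refine (congrArg (fun k ↦ (fromExt J n t).app Y (k.hom e))
    (ext_map_smul_id n (powQuotient J t) Y r)).trans ?_
  exact map_smul ((fromExt J n t).app Y).hom r e

lemma exists_pow_smul_eq_zero {n : ℕ} {Y : ModuleCat.{u} A} (x : (localCohomology J n).obj Y) :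
    ∃ t : ℕ, ∀ r ∈ J ^ t, r • x = 0 := by
  obtain ⟨t, e, rfl⟩ := exists_fromExt x
  refine ⟨t, fun r hr ↦ ?_⟩
  have h : r • 𝟙 (powQuotient J t) = 0 := by
    ext (y : A ⧸ J ^ t)
    obtain ⟨y, rfl⟩ := Ideal.Quotient.mk_surjective y
    exact Ideal.Quotient.eq_zero_iff_mem.mpr (Ideal.mul_mem_right y _ hr)
  refine (map_smul ((fromExt J n t).app Y).hom r e).symm.trans ?_
  exact (congrArg _ (smul_ext_eq_zero n _ Y h e)).trans (map_zero _)

lemma subsingleton_of_injective (n : ℕ) (I : ModuleCat.{u} A) [Injective I] :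
    Subsingleton ((localCohomology J (n + 1)).obj I) := by
  refine subsingleton_of_forall_eq 0 fun x ↦ ?_
  obtain ⟨t, e, rfl⟩ := exists_fromExt x
  have := ext_succ_subsingleton_of_injective n (powQuotient J t) I
  rw [Subsingleton.elim e 0]
  exact map_zero ((fromExt J (n + 1) t).app I).hom

variable (J) in
/-- Evaluation at `1` of a homomorphism `A ⧸ J ^ t ⟶ Y`. -/
def evalOne (t : ℕ) (Y : ModuleCat.{u} A) : ModuleCat.of A (powQuotient J t ⟶ Y) ⟶ Y :=
  ModuleCat.ofHom
    { toFun f := f.hom (1 : A ⧸ J ^ t)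
      map_add' _ _ := rfl
      map_smul' _ _ := rfl }

variable (J) in
lemma evalOne_injective (t : ℕ) (Y : ModuleCat.{u} A) : Function.Injective (evalOne J t Y) := by
  intro (f : powQuotient J t ⟶ Y) (g : powQuotient J t ⟶ Y)
    (h : f.hom (1 : A ⧸ J ^ t) = g.hom (1 : A ⧸ J ^ t))
  refine ModuleCat.hom_ext (Submodule.linearMap_qext (J ^ t) ?_)
  ext
  exact h

instance (X Y : ModuleCat.{u} A) : IsIso (homToExt (resolution X) Y) :=
  (ConcreteCategory.isIso_iff_bijective _).mpr (homToExt_bijective X Y)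

variable (J) in
lemma exists_toModule (Y : ModuleCat.{u} A) : ∃ f : (localCohomology J 0).obj Y ⟶ Y,
    ∀ t, homToExt (resolution (powQuotient J t)) Y ≫ (fromExt J 0 t).app Y ≫ f =
      evalOne J t Y := by
  obtain ⟨f, hf⟩ := exists_hom_of_compatible (J := J) (n := 0) (Y := Y)
    (fun t ↦ inv (homToExt (resolution (powQuotient J t)) Y) ≫ evalOne J t Y) (fun s t h ↦
      comp_inv_comp_eq (homToExt_naturality_left (powQuotientMap J h) Y) rfl)
  exact ⟨f, fun t ↦ (congrArg (_ ≫ ·) (hf t)).trans (IsIso.hom_inv_id_assoc _ _)⟩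

variable (J) in
/-- The inclusion of `H⁰_J(Y)` in `Y` as the submodule of `J`-power torsion elements. -/
def toModule (Y : ModuleCat.{u} A) : (localCohomology J 0).obj Y ⟶ Y :=
  (exists_toModule J Y).choose

lemma toModule_spec (t : ℕ) (Y : ModuleCat.{u} A) (f : powQuotient J t ⟶ Y) :
    toModule J Y ((fromExt J 0 t).app Y (homToExt (resolution (powQuotient J t)) Y f)) =
      evalOne J t Y f :=
  congrArg (fun k ↦ k.hom f) ((exists_toModule J Y).choose_spec t)

lemma exists_hom_rep {Y : ModuleCat.{u} A} (x : (localCohomology J 0).obj Y) :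
    ∃ (t : ℕ) (f : powQuotient J t ⟶ Y),
      (fromExt J 0 t).app Y (homToExt (resolution (powQuotient J t)) Y f) = x := by
  obtain ⟨t, e, rfl⟩ := exists_fromExt x
  obtain ⟨f, rfl⟩ := (homToExt_bijective _ Y).surjective e
  exact ⟨t, f, rfl⟩

variable (J) in
lemma toModule_injective (Y : ModuleCat.{u} A) : Function.Injective (toModule J Y) := by
  refine (injective_iff_map_eq_zero (toModule J Y).hom).mpr fun x hx ↦ ?_
  obtain ⟨t, f, rfl⟩ := exists_hom_rep x
  have h : f = 0 := evalOne_injective J t Y ((toModule_spec t Y f).symm.trans hx)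
  rw [h]
  exact (congrArg _ (map_zero (homToExt (resolution (powQuotient J t)) Y).hom)).trans
    (map_zero ((fromExt J 0 t).app Y).hom)

lemma mem_range_toModule {Y : ModuleCat.{u} A} {y : Y} :
    (∃ x, toModule J Y x = y) ↔ ∃ t : ℕ, ∀ r ∈ J ^ t, r • y = 0 := by
  constructor
  · rintro ⟨x, rfl⟩
    obtain ⟨t, h⟩ := exists_pow_smul_eq_zero x
    exact ⟨t, fun r hr ↦ by rw [← map_smul (toModule J Y).hom, h r hr, map_zero]⟩
  · rintro ⟨t, h⟩
    let f : powQuotient J t ⟶ Y := ModuleCat.ofHom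
      (Submodule.liftQ (J ^ t) (LinearMap.toSpanSingleton A Y y) h)
    exact ⟨_, (toModule_spec t Y f).trans (one_smul A y)⟩

lemma toModule_naturality {Y Y' : ModuleCat.{u} A} (g : Y ⟶ Y') (x : (localCohomology J 0).obj Y) :
    toModule J Y' ((localCohomology J 0).map g x) = g (toModule J Y x) := by
  obtain ⟨t, f, rfl⟩ := exists_hom_rep x
  rw [comp_apply_eq ((fromExt J 0 t).naturality g).symm]
  refine (congrArg (fun z ↦ toModule J Y' ((fromExt J 0 t).app Y' z))
    (comp_apply_eq (homToExt_naturality (resolution (powQuotient J t)) g) f)).trans ?_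
  exact (toModule_spec t Y' _).trans (congrArg g (toModule_spec t Y f)).symm

end localCohomology

variable {A : Type u} [CommRing A]

/-- The local cohomology module `Hⁿ_J(M)` of an unbundled module. -/
def LocalCohomologyModule (J : Ideal A) (n : ℕ) (M : Type u) [AddCommGroup M] [Module A M] :
    Type u := (localCohomology J n).obj (ModuleCat.of A M)

namespace LocalCohomologyModule

variable (J : Ideal A) (n : ℕ) {M N P : Type u} [AddCommGroup M] [Module A M]
  [AddCommGroup N] [Module A N] [AddCommGroup P] [Module A P]

instance : AddCommGroup (LocalCohomologyModule J n M) :=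
  inferInstanceAs (AddCommGroup ((localCohomology J n).obj (ModuleCat.of A M)))

instance : Module A (LocalCohomologyModule J n M) :=
  inferInstanceAs (Module A ((localCohomology J n).obj (ModuleCat.of A M)))

/-- The map induced on local cohomology by a linear map. -/
def map (f : M →ₗ[A] N) : LocalCohomologyModule J n M →ₗ[A] LocalCohomologyModule J n N :=
  ((localCohomology J n).map (ModuleCat.ofHom f)).hom

lemma map_lsmul (r : A) (x : LocalCohomologyModule J n M) :
    map J n (LinearMap.lsmul A M r) x = r • x :=
  localCohomology.map_smul_id n (ModuleCat.of A M) r x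

lemma shortExact_of {f : M →ₗ[A] N} {g : N →ₗ[A] P} (hf : Function.Injective f)
    (hg : Function.Surjective g) (hfg : Function.Exact f g) :
    (ShortComplex.mk (ModuleCat.ofHom f) (ModuleCat.ofHom g)
      (ModuleCat.hom_ext hfg.linearMap_comp_eq_zero)).ShortExact where
  exact := (ShortComplex.ShortExact.moduleCat_exact_iff_function_exact _).mpr hfg
  mono_f := (ModuleCat.mono_iff_injective _).mpr hf
  epi_g := (ModuleCat.epi_iff_surjective _).mpr hg

lemma map_exact {f : M →ₗ[A] N} {g : N →ₗ[A] P} (hf : Function.Injective f)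
    (hg : Function.Surjective g) (hfg : Function.Exact f g) :
    Function.Exact (map J n f) (map J n g) :=
  localCohomology.map_exact J (shortExact_of hf hg hfg) n

lemma exists_connecting {f : M →ₗ[A] N} {g : N →ₗ[A] P} (hf : Function.Injective f)
    (hg : Function.Surjective g) (hfg : Function.Exact f g) :
    ∃ δ : LocalCohomologyModule J n P →ₗ[A] LocalCohomologyModule J (n + 1) M,
      Function.Exact (map J n g) δ ∧ Function.Exact δ (map J (n + 1) f) := by
  obtain ⟨δ, h⟩ := localCohomology.exists_connecting J (shortExact_of hf hg hfg) n
  exact ⟨δ.hom, h⟩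

variable {J n} in
lemma exists_pow_smul_eq_zero (x : LocalCohomologyModule J n M) :
    ∃ t : ℕ, ∀ r ∈ J ^ t, r • x = 0 :=
  localCohomology.exists_pow_smul_eq_zero (Y := ModuleCat.of A M) x

lemma subsingleton_of_injective [Module.Injective A M] :
    Subsingleton (LocalCohomologyModule J (n + 1) M) :=
  have := Module.injective_object_of_injective_module A M
  localCohomology.subsingleton_of_injective n (ModuleCat.of A M)

variable (M) in
/-- The inclusion of `H⁰_J(M)` in `M`. -/
def toModule : LocalCohomologyModule J 0 M →ₗ[A] M :=
  (localCohomology.toModule J (ModuleCat.of A M)).hom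

lemma toModule_injective : Function.Injective (toModule J M) :=
  localCohomology.toModule_injective J (ModuleCat.of A M)

variable {J} in
lemma mem_range_toModule {y : M} :
    (∃ x, toModule J M x = y) ↔ ∃ t : ℕ, ∀ r ∈ J ^ t, r • y = 0 :=
  localCohomology.mem_range_toModule (Y := ModuleCat.of A M)

lemma toModule_map (g : M →ₗ[A] N) (x : LocalCohomologyModule J 0 M) :
    toModule J N (map J 0 g x) = g (toModule J M x) :=
  localCohomology.toModule_naturality (ModuleCat.ofHom g) x

end LocalCohomologyModule

end

section

open Limits

universe u

variable {A : Type u} [CommRing A]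

/-- The submodule of elements annihilated by a power of `J`. -/
def powTorsion (J : Ideal A) (M : Type*) [AddCommGroup M] [Module A M] : Submodule A M where
  carrier := {y | ∃ t : ℕ, ∀ r ∈ J ^ t, r • y = 0}
  zero_mem' := ⟨0, fun _ _ ↦ smul_zero _⟩
  add_mem' := by
    rintro x y ⟨s, hs⟩ ⟨t, ht⟩
    refine ⟨s + t, fun r hr ↦ ?_⟩
    rw [smul_add, hs r (Ideal.pow_le_pow_right le_self_add hr),
      ht r (Ideal.pow_le_pow_right le_add_self hr), add_zero]
  smul_mem' := by
    rintro c x ⟨s, hs⟩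
    exact ⟨s, fun r hr ↦ by rw [smul_comm, hs r hr, smul_zero]⟩

/-- Every element of `M` is annihilated by a power of `J`. -/
def IsPowTorsion (J : Ideal A) (M : Type*) [AddCommGroup M] [Module A M] : Prop :=
  ∀ y : M, ∃ t : ℕ, ∀ r ∈ J ^ t, r • y = 0

lemma Function.Exact.subsingleton {X Y Z : Type*} [AddCommGroup X] [AddCommGroup Y]
    [AddCommGroup Z] [Module A X] [Module A Y] [Module A Z] {f : X →ₗ[A] Y} {g : Y →ₗ[A] Z}
    (h : Function.Exact f g) [Subsingleton X] [Subsingleton Z] : Subsingleton Y := by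
  refine subsingleton_of_forall_eq 0 fun y ↦ ?_
  obtain ⟨x, rfl⟩ := (h y).mp (Subsingleton.elim _ _)
  rw [Subsingleton.elim x 0, map_zero]

section

variable {J : Ideal A} {M N : Type*} [AddCommGroup M] [Module A M] [AddCommGroup N] [Module A N]

lemma IsPowTorsion.of_injective (hN : IsPowTorsion J N) {f : M →ₗ[A] N}
    (hf : Function.Injective f) : IsPowTorsion J M := fun y ↦ by
  obtain ⟨t, ht⟩ := hN (f y)
  exact ⟨t, fun r hr ↦ hf (by rw [map_smul, ht r hr, map_zero])⟩

lemma IsPowTorsion.of_surjective (hM : IsPowTorsion J M) {f : M →ₗ[A] N}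
    (hf : Function.Surjective f) : IsPowTorsion J N := fun y ↦ by
  obtain ⟨x, rfl⟩ := hf y
  obtain ⟨t, ht⟩ := hM x
  exact ⟨t, fun r hr ↦ by rw [← map_smul, ht r hr, map_zero]⟩

variable (J M) in
lemma isPowTorsion_powTorsion : IsPowTorsion J (powTorsion J M) := fun ⟨_, t, ht⟩ ↦
  ⟨t, fun r hr ↦ Subtype.ext (ht r hr)⟩

lemma IsPowTorsion.exists_pow_le_annihilator [Module.Finite A M] (h : IsPowTorsion J M) :
    ∃ t : ℕ, J ^ t ≤ Module.annihilator A M := by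
  obtain ⟨s, hs⟩ := Module.Finite.fg_top (R := A) (M := M)
  choose t ht using h
  refine ⟨s.sup t, fun r hr ↦ ?_⟩
  rw [← Submodule.annihilator_top, ← hs, Submodule.mem_annihilator_span]
  intro ⟨y, hy⟩
  exact ht y r (Ideal.pow_le_pow_right (Finset.le_sup hy) hr)

end

/-- Over a Noetherian ring, the torsion submodule of an injective module is injective. -/
lemma powTorsion_injective [IsNoetherianRing A] (J : Ideal A) (E : Type u) [AddCommGroup E]
    [Module A E] [Module.Injective A E] : Module.Injective A (powTorsion J E) := by
  refine Module.Baer.injective fun I f ↦ ?_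
  have hr : IsPowTorsion J (LinearMap.range f) :=
    (isPowTorsion_powTorsion J E).of_injective (LinearMap.range f).injective_subtype
  obtain ⟨t, ht⟩ := hr.exists_pow_le_annihilator
  obtain ⟨k, hk⟩ := J.exists_pow_inf_eq_pow_smul (I : Submodule A A)
  let p : I →ₗ[A] A ⧸ J ^ (t + k) := (J ^ (t + k)).mkQ ∘ₗ I.subtype
  have hp : LinearMap.ker p ≤ LinearMap.ker ((powTorsion J E).subtype ∘ₗ f) := by
    intro x hx
    have hx' : (x : A) ∈ J ^ (t + k) := by
      exact (Submodule.Quotient.mk_eq_zero _).mp hx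
    have h2 : (x : A) ∈ (J ^ t • I : Ideal A) := by
      have h3 : (x : A) ∈ (J ^ (t + k) • ⊤ ⊓ I : Ideal A) := ⟨by simpa using hx', x.2⟩
      rw [hk (t + k) (by omega), Nat.add_sub_cancel] at h3
      exact Submodule.smul_mono le_rfl inf_le_right h3
    have h4 : x ∈ (J ^ t • ⊤ : Submodule A I) := by
      rwa [← Submodule.comap_map_eq_of_injective I.injective_subtype (J ^ t • ⊤),
        Submodule.mem_comap, Submodule.map_smul'',
        Submodule.map_top, Submodule.range_subtype]
    have h5 : f x = 0 := by
      have : J ^ t • (⊤ : Submodule A I) ≤ LinearMap.ker f := by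
        rw [Submodule.smul_le]
        intro r hr y _
        have := Module.mem_annihilator.mp (ht hr) ⟨f y, y, rfl⟩
        rw [LinearMap.mem_ker, map_smul]
        exact congrArg Subtype.val this
      exact this h4
    rw [LinearMap.mem_ker, LinearMap.comp_apply, h5, map_zero]
  obtain ⟨g, hg⟩ := Module.Injective.out (R := A) (Q := E)
    ((LinearMap.ker p).liftQ p le_rfl)
    (LinearMap.ker_eq_bot.mp (Submodule.ker_liftQ_eq_bot _ _ _ le_rfl))
    ((LinearMap.ker p).liftQ _ hp)
  have hmem : g ((J ^ (t + k)).mkQ 1) ∈ powTorsion J E := ⟨t + k, fun r hr ↦ by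
    rw [← map_smul, ← map_smul, smul_eq_mul, mul_one, Submodule.mkQ_apply,
      (Submodule.Quotient.mk_eq_zero _).mpr hr, map_zero]⟩
  refine ⟨LinearMap.toSpanSingleton A _ ⟨_, hmem⟩, fun x hx ↦ Subtype.ext ?_⟩
  refine Eq.trans ?_ (hg ((LinearMap.ker p).mkQ ⟨x, hx⟩))
  rw [LinearMap.toSpanSingleton_apply, Submodule.coe_smul, ← map_smul, ← map_smul]
  simp [p]

namespace LocalCohomologyModule

variable {J : Ideal A} {M N : Type u} [AddCommGroup M] [Module A M] [AddCommGroup N] [Module A N]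

lemma toModule_surjective (h : IsPowTorsion J M) : Function.Surjective (toModule J M) :=
  fun y ↦ mem_range_toModule.mpr (h y)

lemma map_zero_surjective (h : IsPowTorsion J M) {g : M →ₗ[A] N} (hg : Function.Surjective g) :
    Function.Surjective (map J 0 g) := fun x ↦ by
  obtain ⟨y, hy⟩ := hg (toModule J N x)
  obtain ⟨z, rfl⟩ := toModule_surjective h y
  exact ⟨z, toModule_injective J ((toModule_map J g z).trans hy)⟩

lemma exists_injective_of_isPowTorsion [IsNoetherianRing A] (h : IsPowTorsion J M) :
    ∃ (E : Type u) (_ : AddCommGroup E) (_ : Module A E) (j : M →ₗ[A] E),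
      Module.Injective A E ∧ IsPowTorsion J E ∧ Function.Injective j := by
  let E : ModuleCat.{u} A := Injective.under (ModuleCat.of A M)
  let i : M →ₗ[A] E := (Injective.ι (ModuleCat.of A M)).hom
  have hi : Function.Injective i := (ModuleCat.mono_iff_injective _).mp inferInstance
  have hE : Injective E := inferInstance
  have : Module.Injective A E := Module.injective_module_of_injective_object A E (inj := hE)
  exact ⟨powTorsion J E, inferInstance, inferInstance,
    i.codRestrict _ fun y ↦ (h y).imp fun t ht r hr ↦ by rw [← map_smul, ht r hr, map_zero],
    powTorsion_injective J E, isPowTorsion_powTorsion J E,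
    fun x y hxy ↦ hi (congrArg Subtype.val hxy)⟩

lemma subsingleton_of_isPowTorsion [IsNoetherianRing A] (n : ℕ) (M : Type u) [AddCommGroup M]
    [Module A M] (h : IsPowTorsion J M) : Subsingleton (LocalCohomologyModule J (n + 1) M) := by
  induction n generalizing M with
  | zero =>
    obtain ⟨E, _, _, j, _, hE, hj⟩ := exists_injective_of_isPowTorsion h
    have hs := (LinearMap.range j).mkQ_surjective
    obtain ⟨δ, h₁, h₂⟩ := exists_connecting J 0 hj hs (LinearMap.exact_map_mkQ_range j)
    have := subsingleton_of_injective J 0 (M := E)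
    refine subsingleton_of_forall_eq 0 fun x ↦ ?_
    obtain ⟨y, rfl⟩ := (h₂ x).mp (Subsingleton.elim _ _)
    exact (h₁ y).mpr (map_zero_surjective hE hs y)
  | succ n ih =>
    obtain ⟨E, _, _, j, _, hE, hj⟩ := exists_injective_of_isPowTorsion h
    have hs := (LinearMap.range j).mkQ_surjective
    obtain ⟨δ, h₁, h₂⟩ := exists_connecting J (n + 1) hj hs (LinearMap.exact_map_mkQ_range j)
    have := subsingleton_of_injective J (n + 1) (M := E)
    have := ih _ (hE.of_surjective hs)
    exact h₂.subsingleton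

end LocalCohomologyModule

open Submodule in
/-- A module on which `r` acts locally nilpotently is Artinian if the kernel of `r` is. -/
lemma isArtinian_of_isArtinian_ker {N : Type*} [AddCommGroup N] [Module A N] (r : A)
    (hr : ∀ y : N, ∃ k : ℕ, r ^ k • y = 0) [IsArtinian A (LinearMap.ker (LinearMap.lsmul A N r))] :
    IsArtinian A N := by
  set f := LinearMap.lsmul A N r
  have hf (k : ℕ) (y : N) : (f ^ k) y = r ^ k • y := by
    induction k with
    | zero => simp
    | succ k ih => rw [pow_succ', Module.End.mul_apply, ih, pow_succ', mul_smul]; rfl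
  rw [← monotone_stabilizes_iff_artinian]
  intro B
  let D (n : ℕ) : Submodule A N := OrderDual.ofDual (B n)
  have hD {s t : ℕ} (h : s ≤ t) : D t ≤ D s := B.monotone h
  let C (i n : ℕ) : Submodule A (LinearMap.ker f) :=
    ((D n).map (f ^ i)).comap (LinearMap.ker f).subtype
  have hC {i j s t : ℕ} (h : i ≤ j) (h' : s ≤ t) : C j t ≤ C i s := by
    refine comap_mono ?_
    rintro _ ⟨b, hb, rfl⟩
    obtain ⟨k, rfl⟩ := Nat.exists_eq_add_of_le h
    exact ⟨r ^ k • b, (D s).smul_mem _ (hD h' hb), by rw [pow_add, Module.End.mul_apply, hf k]⟩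
  obtain ⟨k, hk⟩ := IsArtinian.monotone_stabilizes (R := A) (M := LinearMap.ker f)
    ⟨fun n ↦ OrderDual.toDual (C n n), fun s t h ↦ hC h h⟩
  have hi (i : ℕ) : ∃ n, ∀ m ≥ n, C i n = C i m := IsArtinian.monotone_stabilizes
    (R := A) (M := LinearMap.ker f) ⟨fun n ↦ OrderDual.toDual (C i n), fun s t h ↦ hC le_rfl h⟩
  choose t ht using hi
  let n := k ⊔ (Finset.range k).sup t
  have hn (i m : ℕ) (hm : n ≤ m) : C i n ≤ C i m := by
    have h₁ : k ≤ n := le_sup_left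
    rcases lt_or_ge i k with h | h
    · have h₂ : t i ≤ n := (Finset.le_sup (Finset.mem_range.mpr h)).trans le_sup_right
      rw [← ht i n h₂, ← ht i m (h₂.trans hm)]
    · have : C k k = C (i ⊔ m) (i ⊔ m) := hk _ (h.trans le_sup_left)
      exact (hC h h₁).trans (this.le.trans (hC le_sup_left le_sup_right))
  refine ⟨n, fun m hm ↦ le_antisymm (α := (Submodule A N)ᵒᵈ) (B.monotone hm) ?_⟩
  have key (i : ℕ) : ∀ b ∈ D n, (f ^ i) b = 0 → b ∈ D m := by
    induction i with
    | zero =>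
      intro b _ h
      rw [show b = 0 from h]
      exact zero_mem _
    | succ i ih =>
      intro b hb h
      have hz : f ((f ^ i) b) = 0 := by rwa [pow_succ'] at h
      obtain ⟨b', hb', h'⟩ := hn i m hm (show (⟨_, hz⟩ : LinearMap.ker f) ∈ C i n from ⟨b, hb, rfl⟩)
      have h' : (f ^ i) b' = (f ^ i) b := h'
      have := ih (b - b') (sub_mem hb (hD hm hb')) (by rw [map_sub, h', sub_self])
      simpa using add_mem this hb'
  intro b hb
  obtain ⟨i, hi⟩ := hr b
  exact key i b hb ((hf i b).trans hi)

open Submodule in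
lemma exists_finset_forall_pow_smul_le [IsNoetherianRing A] [IsLocalRing A] {L : Type*}
    [AddCommGroup L] [Module A L] [IsArtinian A L] (K : Submodule A L) :
    ∃ F : Finset (Ideal A), (∀ p ∈ F, p.IsPrime ∧ p ≠ IsLocalRing.maximalIdeal A) ∧
      ∀ r ∈ IsLocalRing.maximalIdeal A, (∀ p ∈ F, r ∉ p) →
        ∃ n : ℕ, IsLocalRing.maximalIdeal A ^ n • K ≤ K.map (LinearMap.lsmul A L r) := by
  classical
  set m := IsLocalRing.maximalIdeal A
  induction K using WellFoundedLT.induction with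
  | ind K ih =>
  by_cases h : ∃ K₁ K₂, K₁ < K ∧ K₂ < K ∧ K₁ ⊔ K₂ = K
  · obtain ⟨K₁, K₂, h₁, h₂, rfl⟩ := h
    obtain ⟨F₁, hF₁, hr₁⟩ := ih K₁ h₁
    obtain ⟨F₂, hF₂, hr₂⟩ := ih K₂ h₂
    refine ⟨F₁ ∪ F₂, fun p hp ↦ (Finset.mem_union.mp hp).elim (hF₁ p) (hF₂ p), fun r hr h ↦ ?_⟩
    obtain ⟨n₁, hn₁⟩ := hr₁ r hr fun p hp ↦ h p (Finset.mem_union_left _ hp)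
    obtain ⟨n₂, hn₂⟩ := hr₂ r hr fun p hp ↦ h p (Finset.mem_union_right _ hp)
    refine ⟨n₁ + n₂, ?_⟩
    rw [smul_sup, Submodule.map_sup]
    exact sup_le_sup ((smul_mono (Ideal.pow_le_pow_right le_self_add) le_rfl).trans hn₁)
      ((smul_mono (Ideal.pow_le_pow_right le_add_self) le_rfl).trans hn₂)
  by_cases hK : K = ⊥
  · exact ⟨∅, by simp, fun r _ _ ↦ ⟨0, by simp [hK]⟩⟩
  have key (r : A) : r ∈ K.annihilator.radical ∨ K ≤ K.map (LinearMap.lsmul A L r) := by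
    obtain ⟨k, hk⟩ := IsArtinian.monotone_stabilizes (R := A) (M := L)
      ⟨fun i ↦ OrderDual.toDual (K.map (LinearMap.lsmul A L (r ^ i))), fun i j hij ↦ by
        rintro _ ⟨y, hy, rfl⟩
        obtain ⟨j, rfl⟩ := Nat.exists_eq_add_of_le hij
        exact ⟨r ^ j • y, K.smul_mem _ hy, by simp [pow_add, mul_smul, smul_comm (r ^ i)]⟩⟩
    have hk (i : ℕ) (hi : k ≤ i) : K.map (LinearMap.lsmul A L (r ^ i)) =
      K.map (LinearMap.lsmul A L (r ^ k)) := (hk i hi).symm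
    have h₂ : K.map (LinearMap.lsmul A L (r ^ (k + 1))) ≤ K := by
      rintro _ ⟨y, hy, rfl⟩
      exact K.smul_mem _ hy
    have h₁₂ : K ⊓ LinearMap.ker (LinearMap.lsmul A L (r ^ (k + 1))) ⊔
        K.map (LinearMap.lsmul A L (r ^ (k + 1))) = K := by
      refine le_antisymm (sup_le inf_le_left h₂) fun y hy ↦ ?_
      have hy' : r ^ (k + 1) • y ∈ K.map (LinearMap.lsmul A L (r ^ (k + 1 + (k + 1)))) := by
        rw [hk _ (by omega), ← hk (k + 1) (by omega)]
        exact ⟨y, hy, rfl⟩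
      obtain ⟨z, hz, hyz⟩ := hy'
      refine mem_sup.mpr ⟨y - r ^ (k + 1) • z, ⟨sub_mem hy (K.smul_mem _ hz), ?_⟩,
        r ^ (k + 1) • z, ⟨z, hz, rfl⟩, sub_add_cancel _ _⟩
      simp only [LinearMap.lsmul_apply, pow_add _ (k + 1) (k + 1), mul_smul] at hyz
      simp [smul_sub, hyz]
    rcases h₂.lt_or_eq with h₂ | h₂
    · left
      have h₁ : K ⊓ LinearMap.ker (LinearMap.lsmul A L (r ^ (k + 1))) = K :=
        inf_le_left.eq_or_lt.resolve_right fun h₁ ↦ h ⟨_, _, h₁, h₂, h₁₂⟩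
      exact ⟨k + 1, mem_annihilator.mpr fun y hy ↦ (inf_eq_left.mp h₁) hy⟩
    · right
      intro y hy
      rw [← h₂] at hy
      obtain ⟨z, hz, rfl⟩ := hy
      exact ⟨r ^ k • z, K.smul_mem _ hz, by simp [pow_succ', mul_smul, smul_comm r]⟩
  have hp : K.annihilator.radical.IsPrime := by
    refine ⟨?_, ?_⟩
    · rwa [Ne, Ideal.radical_eq_top, annihilator_eq_top_iff]
    · rintro a b ⟨k, hk⟩
      refine or_iff_not_imp_left.mpr fun ha ↦ ?_
      have ha := (key a).resolve_left ha
      refine ⟨k, mem_annihilator.mpr fun y hy ↦ ?_⟩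
      have (j : ℕ) : ∀ y ∈ K, ∃ z ∈ K, a ^ j • z = y := by
        induction j with
        | zero => exact fun y hy ↦ ⟨y, hy, by simp⟩
        | succ j ih =>
          intro y hy
          obtain ⟨z, hz, rfl⟩ := ih y hy
          obtain ⟨w, hw, rfl⟩ := ha hz
          exact ⟨w, hw, by simp [pow_succ, mul_smul]⟩
      obtain ⟨z, hz, rfl⟩ := this k y hy
      rw [smul_smul, ← mul_pow, mul_comm, mem_annihilator.mp hk z hz]
  by_cases hm : K.annihilator.radical = m
  · obtain ⟨n, hn⟩ := K.annihilator.exists_radical_pow_le_of_fg (IsNoetherian.noetherian _)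
    rw [hm] at hn
    refine ⟨∅, by simp, fun r _ _ ↦ ⟨n, ?_⟩⟩
    rw [smul_le]
    intro a ha y hy
    rw [mem_annihilator.mp (hn ha) y hy]
    exact zero_mem _
  · refine ⟨{K.annihilator.radical}, by simpa using ⟨hp, hm⟩, fun r _ h ↦ ⟨0, ?_⟩⟩
    simpa using (key r).resolve_left (h _ (Finset.mem_singleton_self _))

lemma isNoetherian_iff_isArtinian_of_pow_le_annihilator [IsNoetherianRing A] (J : Ideal A)
    [hJ : J.IsMaximal] (L : Type*) [AddCommGroup L] [Module A L] {n : ℕ}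
    (h : J ^ n ≤ Module.annihilator A L) : IsNoetherian A L ↔ IsArtinian A L := by
  have : Ring.KrullDimLE 0 (A ⧸ J ^ n) := Ring.KrullDimLE.mk₀ fun P hP ↦ by
    have h₁ : J ≤ P.comap (Ideal.Quotient.mk (J ^ n)) :=
      Ideal.IsPrime.le_of_pow_le (n := n) fun x hx ↦ by
        rw [Ideal.mem_comap, Ideal.Quotient.eq_zero_iff_mem.mpr hx]
        exact P.zero_mem
    have h₂ : (P.comap (Ideal.Quotient.mk (J ^ n))).IsMaximal := by
      rwa [← hJ.eq_of_le (Ideal.IsPrime.ne_top inferInstance) h₁]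
    have h₃ := Ideal.map_comap_of_surjective _ Ideal.Quotient.mk_surjective P
    have h₄ := Ideal.map_eq_top_or_isMaximal_of_surjective (Ideal.Quotient.mk (J ^ n))
      Ideal.Quotient.mk_surjective h₂
    rw [h₃] at h₄
    exact h₄.resolve_left hP.ne_top
  have : IsArtinianRing (A ⧸ J ^ n) := isArtinianRing_iff_krullDimLE_zero.mpr this
  have ht : Module.IsTorsionBySet A L (J ^ n : Ideal A) := fun x r ↦
    Module.mem_annihilator.mp (h r.2) x
  let _ := ht.module
  have : IsScalarTower A (A ⧸ J ^ n) L := Module.IsTorsionBySet.isScalarTower ht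
  let σ := algebraMap A (A ⧸ J ^ n)
  have : RingHomSurjective σ := ⟨Ideal.Quotient.mk_surjective⟩
  let f : L →ₛₗ[σ] L :=
    { toFun := id
      map_add' _ _ := rfl
      map_smul' r x := (algebraMap_smul (A ⧸ J ^ n) r x).symm }
  rw [f.isArtinian_iff_of_bijective Function.bijective_id,
    f.isNoetherian_iff_of_bijective Function.bijective_id,
    ← IsSemiprimaryRing.isNoetherian_iff_isArtinian]

end

section

universe u

section

open IsLocalRing

variable {A : Type u} [CommRing A] [IsLocalRing A] {M : Type*} [AddCommGroup M] [Module A M]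

variable (A M) in
lemma supportDim_quotient_powTorsion_le :
    Module.supportDim A (M ⧸ powTorsion (maximalIdeal A) M) ≤ Module.supportDim A M :=
  Module.supportDim_le_of_surjective (Submodule.mkQ _) (Submodule.mkQ_surjective _)

lemma IsPowTorsion.support_subset [Module.Finite A M]
    (h : IsPowTorsion (maximalIdeal A) M) :
    Module.support A M ⊆ {closedPoint A} := fun p hp ↦ by
  obtain ⟨t, ht⟩ := h.exists_pow_le_annihilator
  have h₁ := Ideal.IsPrime.le_of_pow_le (ht.trans (Module.mem_support_iff_of_finite.mp hp))
  exact PrimeSpectrum.ext ((maximalIdeal.isMaximal A).eq_of_le p.2.ne_top h₁).symm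

variable [IsNoetherianRing A] [Module.Finite A M]

lemma isPowTorsion_of_supportDim_eq_zero (h : Module.supportDim A M = 0) :
    IsPowTorsion (maximalIdeal A) M := fun y ↦ by
  have h₁ := _root_.support_of_supportDim_eq_zero A M h
  rw [Module.support_eq_zeroLocus, PrimeSpectrum.zeroLocus_eq_iff] at h₁
  have h₂ : maximalIdeal A ≤ (Module.annihilator A M).radical := h₁ ▸ Ideal.le_radical
  obtain ⟨t, ht⟩ := Ideal.exists_pow_le_of_le_radical_of_fg h₂ (IsNoetherian.noetherian _)
  exact ⟨t, fun r hr ↦ Module.mem_annihilator.mp (ht hr) y⟩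

lemma supportDim_quotient_powTorsion (h : 0 < Module.supportDim A M) :
    Module.supportDim A (M ⧸ powTorsion (maximalIdeal A) M) = Module.supportDim A M := by
  set Γ := powTorsion (maximalIdeal A) M
  have h₁ := (isPowTorsion_powTorsion (maximalIdeal A) M).support_subset
  have h₂ := Module.support_of_exact (LinearMap.exact_subtype_mkQ Γ) Γ.injective_subtype
    Γ.mkQ_surjective
  rcases subsingleton_or_nontrivial (M ⧸ Γ) with hs | hn
  · rw [Module.support_eq_empty (M := M ⧸ Γ), Set.union_empty] at h₂
    refine absurd h (not_lt_of_ge ?_)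
    have : Subsingleton (Module.support A M) :=
      (Set.subsingleton_singleton.anti (h₂ ▸ h₁)).coe_sort
    exact Order.krullDim_nonpos_of_subsingleton
  · have h₃ : closedPoint A ∈ Module.support A (M ⧸ Γ) :=
      closedPoint_mem_support A (M ⧸ Γ)
    rw [Set.union_eq_right.mpr (h₁.trans (Set.singleton_subset_iff.mpr h₃))] at h₂
    rw [Module.supportDim, Module.supportDim, h₂]

variable (A M) in
lemma mem_powTorsion_of_smul_mem {x : M}
    (h : ∀ r ∈ maximalIdeal A, r • x ∈ powTorsion (maximalIdeal A) M) :
    x ∈ powTorsion (maximalIdeal A) M := by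
  obtain ⟨t, ht⟩ := (isPowTorsion_powTorsion (maximalIdeal A) M).exists_pow_le_annihilator
  refine ⟨t + 1, fun r hr ↦ ?_⟩
  rw [pow_succ] at hr
  refine Submodule.mul_induction_on hr (fun a ha b hb ↦ ?_) fun a b ha hb ↦ ?_
  · rw [mul_smul]
    exact congrArg Subtype.val (Module.mem_annihilator.mp (ht ha) ⟨_, h b hb⟩)
  · rw [add_smul, ha, hb, add_zero]

lemma eq_zero_of_mem_powTorsion_quotient {y : M ⧸ powTorsion (maximalIdeal A) M}
    (hy : y ∈ powTorsion (maximalIdeal A) (M ⧸ powTorsion (maximalIdeal A) M)) : y = 0 := by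
  obtain ⟨t, ht⟩ := hy
  induction t generalizing y with
  | zero => simpa using ht 1 (by simp)
  | succ t ih =>
    obtain ⟨x, rfl⟩ := Submodule.Quotient.mk_surjective _ y
    refine (Submodule.Quotient.mk_eq_zero _).mpr (mem_powTorsion_of_smul_mem A M fun r hr ↦ ?_)
    refine (Submodule.Quotient.mk_eq_zero _).mp (ih fun s hs ↦ ?_)
    rw [Submodule.Quotient.mk_smul, ← mul_smul]
    exact ht _ (Ideal.mul_mem_mul hs hr)

/-- Prime avoidance: an element of the maximal ideal regular on `M` modulo torsion and outside
finitely many given non-maximal primes. -/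
lemma exists_isSMulRegular_quotient_powTorsion (F : Finset (Ideal A))
    (hF : ∀ p ∈ F, p.IsPrime ∧ p ≠ maximalIdeal A) :
    ∃ r ∈ maximalIdeal A, (∀ p ∈ F, r ∉ p) ∧
      IsSMulRegular (M ⧸ powTorsion (maximalIdeal A) M) r := by
  classical
  set N := M ⧸ powTorsion (maximalIdeal A) M
  have hfin := associatedPrimes.finite A N
  have hG : ∀ p ∈ F ∪ hfin.toFinset, p.IsPrime ∧ p ≠ maximalIdeal A := fun p hp ↦ by
    rcases Finset.mem_union.mp hp with hp | hp
    · exact hF p hp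
    · have hp' : IsAssociatedPrime p N := hfin.mem_toFinset.mp hp
      refine ⟨hp'.isPrime, ?_⟩
      rintro rfl
      obtain ⟨h₁, x, hx⟩ := isAssociatedPrime_iff.mp hp'
      have hx0 : x = 0 := eq_zero_of_mem_powTorsion_quotient ⟨1, fun r hr ↦ by
        rw [pow_one, hx] at hr
        simpa [Submodule.mem_colon_singleton] using hr⟩
      exact h₁.ne_top (by rw [hx, hx0]; ext; simp [Submodule.mem_colon_singleton])
  have key := mt (Ideal.subset_union_prime (s := F ∪ hfin.toFinset) (f := id) ⊤ ⊤
    (I := maximalIdeal A) fun p hp _ _ ↦ (hG p hp).1).mp fun ⟨p, hp, hle⟩ ↦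
      (hG p hp).2 ((maximalIdeal.isMaximal A).eq_of_le (hG p hp).1.ne_top hle).symm
  obtain ⟨r, hr, hr'⟩ := Set.not_subset.mp key
  simp only [Set.mem_iUnion, not_exists, SetLike.mem_coe] at hr'
  refine ⟨r, hr, fun p hp ↦ hr' p (Finset.mem_union_left _ hp), ?_⟩
  by_contra hreg
  have : r ∈ ⋃ p ∈ associatedPrimes A N, (p : Set A) := by
    rw [biUnion_associatedPrimes_eq_compl_regular]
    exact hreg
  obtain ⟨p, hp, hrp⟩ := Set.mem_iUnion₂.mp this
  exact hr' p (Finset.mem_union_right _ (hfin.mem_toFinset.mpr hp)) hrp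

end

namespace LocalCohomologyModule

open IsLocalRing
open scoped Pointwise

section

variable {A : Type u} [CommRing A] (J : Ideal A) {M : Type u} [AddCommGroup M] [Module A M]

lemma exact_lsmul_mkQ (r : A) :
    Function.Exact (LinearMap.lsmul A M r) (r • (⊤ : Submodule A M)).mkQ := fun y ↦ by
  rw [Submodule.mkQ_apply, Submodule.Quotient.mk_eq_zero, Submodule.mem_smul_pointwise_iff_exists]
  simp

lemma exact_lsmul_map_mkQ (n : ℕ) {r : A} (hr : IsSMulRegular M r) :
    Function.Exact (LinearMap.lsmul A (LocalCohomologyModule J n M) r)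
      (map J n (r • (⊤ : Submodule A M)).mkQ) := by
  have h := map_exact J n (f := LinearMap.lsmul A M r) hr (Submodule.mkQ_surjective _)
    (exact_lsmul_mkQ r)
  have hr' : map J n (LinearMap.lsmul A M r) =
      LinearMap.lsmul A (LocalCohomologyModule J n M) r := LinearMap.ext (map_lsmul J n r)
  rwa [hr'] at h

lemma exists_connecting_smul (n : ℕ) {r : A} (hr : IsSMulRegular M r) :
    ∃ δ : LocalCohomologyModule J n (QuotSMulTop r M) →ₗ[A] LocalCohomologyModule J (n + 1) M,
      Function.Exact (map J n (r • (⊤ : Submodule A M)).mkQ) δ ∧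
        Function.Exact δ (LinearMap.lsmul A (LocalCohomologyModule J (n + 1) M) r) := by
  obtain ⟨δ, h₁, h₂⟩ := exists_connecting J n (f := LinearMap.lsmul A M r) hr
    (Submodule.mkQ_surjective _) (exact_lsmul_mkQ r)
  exact ⟨δ, h₁, fun x ↦ by rw [← h₂ x, map_lsmul]; rfl⟩

variable {J} in
lemma subsingleton_of_injective_smul {n : ℕ} {r : A} (hr : r ∈ J)
    (h : Function.Injective (LinearMap.lsmul A (LocalCohomologyModule J n M) r)) :
    Subsingleton (LocalCohomologyModule J n M) := by
  refine subsingleton_of_forall_eq 0 fun x ↦ ?_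
  obtain ⟨t, ht⟩ := exists_pow_smul_eq_zero x
  have hreg : IsSMulRegular (LocalCohomologyModule J n M) r := h
  exact (hreg.pow t).right_eq_zero_of_smul (ht _ (Ideal.pow_mem_pow hr t))

variable [IsNoetherianRing A] (M)

lemma map_mkQ_powTorsion_injective (n : ℕ) :
    Function.Injective (map J (n + 1) (powTorsion J M).mkQ) := by
  have := subsingleton_of_isPowTorsion n _ (isPowTorsion_powTorsion J M)
  rw [injective_iff_map_eq_zero]
  intro x hx
  obtain ⟨y, rfl⟩ := (map_exact J (n + 1) (powTorsion J M).injective_subtype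
    (powTorsion J M).mkQ_surjective (LinearMap.exact_subtype_mkQ _) x).mp hx
  rw [Subsingleton.elim y 0, map_zero]

lemma map_mkQ_powTorsion_surjective (n : ℕ) :
    Function.Surjective (map J n (powTorsion J M).mkQ) := by
  have := subsingleton_of_isPowTorsion n _ (isPowTorsion_powTorsion J M)
  obtain ⟨δ, h, -⟩ := exists_connecting J n (powTorsion J M).injective_subtype
    (powTorsion J M).mkQ_surjective (LinearMap.exact_subtype_mkQ _)
  exact fun x ↦ (h x).mp (Subsingleton.elim _ _)

end

variable {A : Type u} [CommRing A] [IsNoetherianRing A] [IsLocalRing A]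

/-- Local cohomology vanishes above the dimension of the module. -/
theorem subsingleton_of_supportDim_lt (n : ℕ) (M : Type u) [AddCommGroup M] [Module A M]
    [Module.Finite A M] (h : Module.supportDim A M < n) :
    Subsingleton (LocalCohomologyModule (maximalIdeal A) n M) := by
  induction n generalizing M with
  | zero =>
    have : Subsingleton M := by
      rw [← Module.supportDim_eq_bot_iff_subsingleton (R := A)]
      by_contra hb
      have := Module.supportDim_ne_bot_iff_nontrivial A M |>.mp hb
      have := Order.krullDim_nonneg_iff.mpr
        (Module.nonempty_support_of_nontrivial (R := A) (M := M)).to_subtype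
      exact absurd h (not_lt_of_ge this)
    exact (toModule_injective (maximalIdeal A) (M := M)).subsingleton
  | succ n ih =>
    obtain ⟨r, hr, -, hreg⟩ :=
      exists_isSMulRegular_quotient_powTorsion (A := A) (M := M) ∅ (by simp)
    have hdim := Module.supportDim_quotSMulTop_succ_eq_supportDim hreg hr
    have := ih (QuotSMulTop r (M ⧸ powTorsion (maximalIdeal A) M)) (by
      by_contra! hle
      refine absurd h (not_lt_of_ge ?_)
      refine le_trans ?_ (hdim.le.trans (supportDim_quotient_powTorsion_le A M))
      push_cast
      gcongr)
    obtain ⟨δ, -, h₂⟩ := exists_connecting_smul (maximalIdeal A) n hreg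
    have := subsingleton_of_injective_smul (n := n + 1) hr ((injective_iff_map_eq_zero _).mpr
      fun x hx ↦ by
        obtain ⟨y, rfl⟩ := (h₂ x).mp hx
        rw [Subsingleton.elim y 0, map_zero])
    exact (map_mkQ_powTorsion_injective (maximalIdeal A) M n).subsingleton

/-- Local cohomology of a finite module at the maximal ideal is Artinian. -/
theorem isArtinian (n : ℕ) (M : Type u) [AddCommGroup M] [Module A M] [Module.Finite A M] :
    IsArtinian A (LocalCohomologyModule (maximalIdeal A) n M) := by
  induction n generalizing M with
  | zero =>
    have hN : IsNoetherian A (LocalCohomologyModule (maximalIdeal A) 0 M) :=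
      isNoetherian_of_injective _ (toModule_injective (maximalIdeal A))
    have ht : IsPowTorsion (maximalIdeal A) (LocalCohomologyModule (maximalIdeal A) 0 M) :=
      exists_pow_smul_eq_zero
    obtain ⟨t, ht⟩ := ht.exists_pow_le_annihilator
    exact (isNoetherian_iff_isArtinian_of_pow_le_annihilator _ _ ht).mp hN
  | succ n ih =>
    obtain ⟨r, hr, -, hreg⟩ :=
      exists_isSMulRegular_quotient_powTorsion (A := A) (M := M) ∅ (by simp)
    obtain ⟨δ, -, h₂⟩ := exists_connecting_smul (maximalIdeal A) n hreg
    have := ih (QuotSMulTop r (M ⧸ powTorsion (maximalIdeal A) M))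
    have : IsArtinian A (LinearMap.ker (LinearMap.lsmul A (LocalCohomologyModule
        (maximalIdeal A) (n + 1) (M ⧸ powTorsion (maximalIdeal A) M)) r)) := by
      rw [h₂.linearMap_ker_eq]
      exact isArtinian_of_surjective _ δ.rangeRestrict δ.surjective_rangeRestrict
    have := isArtinian_of_isArtinian_ker (N := LocalCohomologyModule (maximalIdeal A) (n + 1)
      (M ⧸ powTorsion (maximalIdeal A) M)) r fun y ↦
        (exists_pow_smul_eq_zero y).imp fun t ht ↦ ht _ (Ideal.pow_mem_pow hr t)
    exact isArtinian_of_injective _ (map_mkQ_powTorsion_injective (maximalIdeal A) M n)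

/-- In positive degree, top local cohomology vanishes as soon as it is finitely generated. -/
theorem subsingleton_of_finite (n : ℕ) (M : Type u) [AddCommGroup M] [Module A M]
    [Module.Finite A M] (h : Module.supportDim A M ≤ (n + 1 : ℕ))
    [Module.Finite A (LocalCohomologyModule (maximalIdeal A) (n + 1) M)] :
    Subsingleton (LocalCohomologyModule (maximalIdeal A) (n + 1) M) := by
  obtain ⟨r, hr, -, hreg⟩ :=
    exists_isSMulRegular_quotient_powTorsion (A := A) (M := M) ∅ (by simp)
  have hdim := Module.supportDim_quotSMulTop_succ_eq_supportDim hreg hr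
  have := subsingleton_of_supportDim_lt (n + 1)
    (QuotSMulTop r (M ⧸ powTorsion (maximalIdeal A) M)) (by
      by_contra! hle
      have h₁ : ((n + 1 : ℕ) : WithBot ℕ∞) + 1 ≤ (n + 1 : ℕ) :=
        (add_le_add_left hle 1).trans (hdim.le.trans
          ((supportDim_quotient_powTorsion_le A M).trans h))
      exact absurd (by exact_mod_cast h₁) (Nat.not_succ_le_self (n + 1)))
  set H := LocalCohomologyModule (maximalIdeal A) (n + 1) (M ⧸ powTorsion (maximalIdeal A) M)
  have : Module.Finite A H :=
    Module.Finite.of_surjective _ (map_mkQ_powTorsion_surjective (maximalIdeal A) M (n + 1))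
  have htop : (⊤ : Submodule A H) = ⊥ := by
    refine Submodule.eq_bot_of_le_smul_of_le_jacobson_bot (maximalIdeal A) _
      Module.Finite.fg_top (fun y _ ↦ ?_) (maximalIdeal_le_jacobson _)
    obtain ⟨z, rfl⟩ := (exact_lsmul_map_mkQ (maximalIdeal A) (n + 1) hreg y).mp
      (Subsingleton.elim _ _)
    exact Submodule.smul_mem_smul hr trivial
  have : Subsingleton H := by
    rwa [eq_comm, subsingleton_iff_bot_eq_top, Submodule.subsingleton_iff] at htop
  exact (map_mkQ_powTorsion_injective (maximalIdeal A) M n).subsingleton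

/-- Local cohomology of a finite module does not vanish in the degree given by its dimension. -/
theorem not_subsingleton_of_supportDim_eq (n : ℕ) (M : Type u) [AddCommGroup M] [Module A M]
    [Module.Finite A M] (h : Module.supportDim A M = n) :
    ¬ Subsingleton (LocalCohomologyModule (maximalIdeal A) n M) := by
  induction n generalizing M with
  | zero =>
    intro hs
    have := (toModule_surjective (isPowTorsion_of_supportDim_eq_zero h)).subsingleton
    simp [Module.supportDim_eq_bot_of_subsingleton] at h
  | succ n ih =>
    intro hs
    set N := M ⧸ powTorsion (maximalIdeal A) M
    have hN : Module.supportDim A N = (n + 1 : ℕ) := h ▸ supportDim_quotient_powTorsion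
      (h ▸ by exact_mod_cast n.succ_pos)
    have : Subsingleton (LocalCohomologyModule (maximalIdeal A) (n + 1) N) :=
      (map_mkQ_powTorsion_surjective (maximalIdeal A) M (n + 1)).subsingleton
    have hArt := isArtinian (A := A) n N
    obtain ⟨F, hF, hF'⟩ := exists_finset_forall_pow_smul_le
      (⊤ : Submodule A (LocalCohomologyModule (maximalIdeal A) n N))
    obtain ⟨r, hr, hrF, hreg⟩ := exists_isSMulRegular_quotient_powTorsion (M := M) F hF
    have hdim : Module.supportDim A (QuotSMulTop r N) = n := by
      have := hN ▸ Module.supportDim_quotSMulTop_succ_eq_supportDim hreg hr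
      generalize Module.supportDim A (QuotSMulTop r N) = a at this
      cases a with
      | bot => exact absurd (this.symm.trans (WithBot.bot_add 1)) WithBot.coe_ne_bot
      | coe a =>
        have h' : a + 1 = (n : ℕ∞) + 1 := by exact_mod_cast this
        exact congrArg _ (ENat.add_left_injective_of_ne_top (n := 1) (by simp) h')
    obtain ⟨δ, h₁, -⟩ := exists_connecting_smul (maximalIdeal A) n hreg
    have hsurj : Function.Surjective
        (map (maximalIdeal A) n (r • (⊤ : Submodule A N)).mkQ) := fun x ↦
      (h₁ x).mp (Subsingleton.elim _ _)
    obtain _ | n := n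
    · have : Subsingleton (LocalCohomologyModule (maximalIdeal A) 0 N) := by
        refine subsingleton_of_forall_eq 0 fun x ↦ toModule_injective (maximalIdeal A) ?_
        rw [map_zero]
        exact eq_zero_of_mem_powTorsion_quotient (mem_range_toModule.mp ⟨x, rfl⟩)
      exact ih _ hdim hsurj.subsingleton
    · obtain ⟨k, hk⟩ := hF' r hr hrF
      have hann : maximalIdeal A ^ k ≤ Module.annihilator A
          (LocalCohomologyModule (maximalIdeal A) (n + 1) (QuotSMulTop r N)) := fun s hs ↦ by
        refine Module.mem_annihilator.mpr fun x ↦ ?_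
        obtain ⟨y, rfl⟩ := hsurj x
        obtain ⟨z, -, hz⟩ := hk (Submodule.smul_mem_smul hs (Submodule.mem_top (x := y)))
        rw [← map_smul]
        exact (exact_lsmul_map_mkQ (maximalIdeal A) (n + 1) hreg _).mpr ⟨z, hz⟩
      have := (isNoetherian_iff_isArtinian_of_pow_le_annihilator _ _ hann).mpr (isArtinian _ _)
      exact ih _ hdim (subsingleton_of_finite n _ hdim.le)

end LocalCohomologyModule

end

theorem grothendieck_nonvanishing
    (A : Type) [CommRing A] [IsNoetherianRing A] [IsLocalRing A]
    (M : Type) [AddCommGroup M] [Module A M] [Module.Finite A M] [Nontrivial M]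
    (d : ℕ) (hA : ringKrullDim A = (d : ℕ))
    (hM : ringKrullDim (A ⧸ Module.annihilator A M) = (d : ℕ)) :
    ¬ Subsingleton ((localCohomology (IsLocalRing.maximalIdeal A) d).obj (ModuleCat.of A M)) := by
  rw [← Module.supportDim_eq_ringKrullDim_quotient_annihilator] at hM
  exact LocalCohomologyModule.not_subsingleton_of_supportDim_eq d M hM
end
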